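/- (Lemma 2.1(ii).) Let d = 1, p = p_c. Let ε ∈ (0,1), t ≥ 1, and let w ≥ 1 be an integer such that V_{p_c}(w,3t) ≥ ε and H_{p_c}(w,3t) ≤ 1 − ε. Then for all integers j ≥ 2 and x with j·w < x ≤ (j+1)·w and x + t even, τ(x,t) ≤ ε^{−4} · θ_t² · (1−ε)^{j−2}. -/

import Mathlib

/-!
Common set-up: nearest-neighbour oriented bond percolation on the space-time
lattice `ℤ^d × ℕ`.  A (potential) bond is a pair `((x, s), y)`, representing
the oriented bond from `(x, s)` to `(y, s + 1)` (it is a genuine bond when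
`‖x - y‖₁ = 1`).  Each bond is occupied (`true`) with probability `p`,
independently of all other bonds.  The product Bernoulli(`p`) measure on
configurations is constructed explicitly as the pushforward of the uniform
measure on `[0,1)`: the binary digits of a uniform sample are i.i.d. fair
coin flips, which are re-packed (via the pairing function) into an i.i.d.
sequence of uniform random variables `unif i`, one for each bond, and the
bond indexed by `i` is occupied exactly when `unif i < p`.
-/

open MeasureTheory Filter Set
open scoped Classical ENNReal Topology

namespace OrientedPercolation

/-- A potential bond of the `d`-dimensional space-time lattice: `((x, s), y)`
represents the oriented pair from `(x, s)` to `(y, s + 1)`. -/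
abbrev Bond (d : ℕ) := ((Fin d → ℤ) × ℕ) × (Fin d → ℤ)

/-- A bond configuration: each potential bond is occupied (`true`) or vacant (`false`). -/
abbrev Config (d : ℕ) := Bond d → Bool

/-- The ℓ¹-norm of a point of `ℤ^d`. -/
def norm1 {d : ℕ} (x : Fin d → ℤ) : ℤ := ∑ i, |x i|

/-- The squared Euclidean norm of a point of `ℤ^d`. -/
def normSq {d : ℕ} (x : Fin d → ℤ) : ℤ := ∑ i, (x i) ^ 2

/-- The `n`-th binary digit of `x ∈ [0,1)`. -/
noncomputable def digit (n : ℕ) (x : ℝ) : ℕ := ⌊x * 2 ^ (n + 1)⌋.toNat % 2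

/-- From a single uniform sample on `[0,1)`, an i.i.d. sequence of uniform
samples on `[0,1]`, obtained by splitting the binary digits via the pairing
function. -/
noncomputable def unif (i : ℕ) (x : ℝ) : ℝ :=
  ∑' k : ℕ, (digit (Nat.pair i k) x : ℝ) / 2 ^ (k + 1)

/-- An injective encoding of the bonds by natural numbers. -/
noncomputable def enc (d : ℕ) : Bond d → ℕ := (exists_injective_nat (Bond d)).choose

/-- The i.i.d. Bernoulli(`p`) bond configuration built from a uniform sample `x`. -/
noncomputable def config (d : ℕ) (p : ℝ) (x : ℝ) : Config d :=
  fun b => if unif (enc d b) x < p then true else false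

/-- The product Bernoulli(`p`) measure `ℙ_p` on bond configurations. -/
noncomputable def P (d : ℕ) (p : ℝ) : Measure (Config d) :=
  Measure.map (config d p) ((volume : Measure ℝ).restrict (Set.Ico 0 1))

/-- `ConnectedIn ω R x s y t` : either `(x,s) = (y,t) ∈ R`, or there is a path of
occupied bonds from `(x, s)` to `(y, t)`, all of whose vertices lie in `R`. -/
def ConnectedIn {d : ℕ} (ω : Config d) (R : Set ((Fin d → ℤ) × ℕ))
    (x : Fin d → ℤ) (s : ℕ) (y : Fin d → ℤ) (t : ℕ) : Prop :=
  (x = y ∧ s = t ∧ (x, s) ∈ R) ∨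
  (s < t ∧ ∃ v : ℕ → (Fin d → ℤ), v s = x ∧ v t = y ∧
    (∀ j, s ≤ j → j ≤ t → (v j, j) ∈ R) ∧
    (∀ j, s ≤ j → j < t → norm1 (v (j + 1) - v j) = 1 ∧ ω ((v j, j), v (j + 1)) = true))

/-- `(x, s) → (y, t)` : `(x,s) = (y,t)` or there is a path of occupied bonds from
`(x, s)` to `(y, t)`. -/
def Connected {d : ℕ} (ω : Config d) (x : Fin d → ℤ) (s : ℕ) (y : Fin d → ℤ) (t : ℕ) : Prop :=
  ConnectedIn ω Set.univ x s y t

/-- The survival probability `θ_t = ℙ_p((o,0) → t)`. -/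
noncomputable def theta (d : ℕ) (p : ℝ) (t : ℕ) : ℝ :=
  (P d p {ω | ∃ y, Connected ω 0 0 y t}).toReal

/-- The two-point function `τ(x,t) = ℙ_p((o,0) → (x,t))`. -/
noncomputable def tau (d : ℕ) (p : ℝ) (x : Fin d → ℤ) (t : ℕ) : ℝ :=
  (P d p {ω | Connected ω 0 0 x t}).toReal

/-- The expected number of vertices at time `t` connected from the origin,
`χ_t = Σ_x τ(x,t)`. -/
noncomputable def chi (d : ℕ) (p : ℝ) (t : ℕ) : ℝ := ∑' x : Fin d → ℤ, tau d p x t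

/-- The gyration radius `ξ_t = (χ_t⁻¹ Σ_x |x|² τ(x,t))^(1/2)`. -/
noncomputable def xi (d : ℕ) (p : ℝ) (t : ℕ) : ℝ :=
  Real.sqrt ((∑' x : Fin d → ℤ, (normSq x : ℝ) * tau d p x t) / chi d p t)

/-- The critical point `p_c = inf {p ∈ [0,1] : θ_∞ > 0}` (here `θ_∞ = lim_t θ_t = inf_t θ_t`,
since `θ_t` is nonincreasing in `t` and nonnegative). -/
noncomputable def pc (d : ℕ) : ℝ :=
  sInf {p ∈ Set.Icc (0 : ℝ) 1 | 0 < ⨅ t : ℕ, theta d p t}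

/-- The rectangle `[a, b] × [0, t]` (for `d = 1`). -/
def rect (a b : ℤ) (t : ℕ) : Set ((Fin 1 → ℤ) × ℕ) :=
  {v | a ≤ v.1 0 ∧ v.1 0 ≤ b ∧ v.2 ≤ t}

/-- The rectangle `[a, b] × [0, t]` is crossed vertically: there is a path of occupied
bonds inside the rectangle from some vertex `(x, 0)` to some vertex `(y, t)`. -/
def CrossedVert (ω : Config 1) (a b : ℤ) (t : ℕ) : Prop :=
  ∃ x y : Fin 1 → ℤ, ConnectedIn ω (rect a b t) x 0 y t

/-- The rectangle `[a, b] × [0, t]` is crossed from left to right: there is a path of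
occupied bonds inside the rectangle containing a vertex with first coordinate `a` and
a vertex with first coordinate `b`. -/
def CrossedHoriz (ω : Config 1) (a b : ℤ) (t : ℕ) : Prop :=
  ∃ (x y : Fin 1 → ℤ) (s u : ℕ), x 0 = a ∧ y 0 = b ∧
    (ConnectedIn ω (rect a b t) x s y u ∨ ConnectedIn ω (rect a b t) y u x s)

/-- `V_p(w, t) = ℙ_p([0,w] × [0,t] is crossed vertically)`. -/
noncomputable def V (p : ℝ) (w : ℕ) (t : ℕ) : ℝ :=
  (P 1 p {ω | CrossedVert ω 0 w t}).toReal

/-- `H_p(w, t) = ℙ_p([0,w] × [0,t] is crossed from left to right)`. -/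
noncomputable def H (p : ℝ) (w : ℕ) (t : ℕ) : ℝ :=
  (P 1 p {ω | CrossedHoriz ω 0 w t}).toReal

/-- The event that `(o, 0)` is connected, inside the box `B_o = [-w,w] × [0,t]`, to the
boundary `∂B_o = {(x,s) ∈ B_o : s = t or |x| = w}`. -/
def ToBoundary (ω : Config 1) (w : ℕ) (t : ℕ) : Prop :=
  ∃ (y : Fin 1 → ℤ) (s : ℕ), (s = t ∨ |y 0| = w) ∧
    ConnectedIn ω (rect (-(w : ℤ)) w t) 0 0 y s

/-! ### The measure `P` is a product measure -/

/-- Lebesgue measure on `[0,1)`. -/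
noncomputable def unitMeas : Measure ℝ := (volume : Measure ℝ).restrict (Set.Ico 0 1)

instance : IsProbabilityMeasure unitMeas := ⟨by simp [unitMeas]⟩

lemma measurable_digit (n : ℕ) : Measurable (digit n) := by
  have h : Measurable (fun z : ℤ => z.toNat % 2) := measurable_of_countable _
  exact h.comp (Int.measurable_floor.comp (measurable_id.mul_const _))

/-- The law of one binary digit. -/
noncomputable def fair : Measure ℕ := unitMeas.map (digit 0)

instance : IsProbabilityMeasure fair :=
  Measure.isProbabilityMeasure_map (measurable_digit 0).aemeasurable

lemma vol_half (c : ℝ) (E : Set ℝ) :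
    volume {x : ℝ | 2 * x - c ∈ E} = ENNReal.ofReal (1 / 2) * volume E := by
  have h1 : {x : ℝ | 2 * x - c ∈ E} = (fun x => 2 * x) ⁻¹' ((fun y => y + (-c)) ⁻¹' E) := by
    ext x; simp [sub_eq_add_neg]
  rw [h1, Real.volume_preimage_mul_left (by norm_num), measure_preimage_add_right]
  norm_num [abs_of_pos]

lemma vol_split (t0 : Set ℕ) (E : Set ℝ) (hE : MeasurableSet E) (hE1 : E ⊆ Set.Ico 0 1) :
    volume {x : ℝ | (0 ∈ t0 ∧ 2 * x - 0 ∈ E) ∨ (1 ∈ t0 ∧ 2 * x - 1 ∈ E)} =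
      (if 0 ∈ t0 then ENNReal.ofReal (1 / 2) else 0) * volume E +
        (if 1 ∈ t0 then ENNReal.ofReal (1 / 2) else 0) * volume E := by
  have hm : ∀ c : ℝ, MeasurableSet {x : ℝ | 2 * x - c ∈ E} := by
    intro c
    exact (show Measurable (fun x : ℝ => 2 * x - c) by fun_prop) hE
  have hd : Disjoint {x : ℝ | 0 ∈ t0 ∧ 2 * x - 0 ∈ E} {x : ℝ | 1 ∈ t0 ∧ 2 * x - 1 ∈ E} := by
    rw [Set.disjoint_left]
    rintro x ⟨_, h1⟩ ⟨_, h2⟩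
    have := hE1 h1
    have := hE1 h2
    simp only [Set.mem_Ico] at *
    linarith
  have h2 : MeasurableSet {x : ℝ | 1 ∈ t0 ∧ 2 * x - 1 ∈ E} :=
    MeasurableSet.inter (MeasurableSet.const _) (hm 1)
  have := measure_union (μ := volume) hd h2
  rw [← Set.ofPred_or] at this
  rw [this]
  congr 1
  · split_ifs with h
    · simp only [h, true_and]; exact vol_half 0 E
    · simp [h]
  · split_ifs with h
    · simp only [h, true_and]; exact vol_half 1 E
    · simp [h]

lemma digit_zero_of_lt {x : ℝ} (h0 : 0 ≤ x) (h1 : x < 1 / 2) : digit 0 x = 0 := by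
  have : ⌊x * 2 ^ (0 + 1)⌋ = 0 := by
    rw [Int.floor_eq_iff]; constructor <;> norm_num <;> linarith
  simp only [digit, this]; rfl

lemma digit_zero_of_ge {x : ℝ} (h0 : 1 / 2 ≤ x) (h1 : x < 1) : digit 0 x = 1 := by
  have : ⌊x * 2 ^ (0 + 1)⌋ = 1 := by
    rw [Int.floor_eq_iff]; constructor <;> norm_num <;> linarith
  simp only [digit, this]; rfl

lemma digit_succ_aux {x : ℝ} (c : ℕ) (h0 : 0 ≤ 2 * x - c) (k : ℕ) :
    digit (k + 1) x = digit k (2 * x - c) := by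
  have h : x * 2 ^ (k + 1 + 1) = (2 * x - c) * 2 ^ (k + 1) + ((c * 2 ^ (k + 1) : ℕ) : ℤ) := by
    push_cast; ring
  have hf : 0 ≤ ⌊(2 * x - c) * 2 ^ (k + 1)⌋ := Int.floor_nonneg.2 (by positivity)
  unfold digit
  rw [h, Int.floor_add_intCast, Int.toNat_add hf (by positivity), Int.toNat_natCast]
  have : c * 2 ^ (k + 1) = 2 * (c * 2 ^ k) := by ring
  omega

lemma digit_box (t : ℕ → Set ℕ) (n : ℕ) :
    unitMeas {x | ∀ k < n, digit k x ∈ t k} = ∏ k ∈ Finset.range n, fair (t k) := by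
  have hB : ∀ (n : ℕ) (t : ℕ → Set ℕ), MeasurableSet {x | ∀ k < n, digit k x ∈ t k} := by
    intro n t
    have : {x | ∀ k < n, digit k x ∈ t k} = ⋂ k, ⋂ (_ : k < n), (digit k) ⁻¹' (t k) := by
      ext; simp
    rw [this]
    exact MeasurableSet.iInter fun k => MeasurableSet.iInter fun _ =>
      measurable_digit k (MeasurableSet.of_discrete)
  have key : ∀ (n : ℕ) (t : ℕ → Set ℕ), unitMeas {x | ∀ k < n + 1, digit k x ∈ t k} =
      (if 0 ∈ t 0 then ENNReal.ofReal (1 / 2) else 0) *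
          unitMeas {x | ∀ k < n, digit k x ∈ t (k + 1)} +
        (if 1 ∈ t 0 then ENNReal.ofReal (1 / 2) else 0) *
          unitMeas {x | ∀ k < n, digit k x ∈ t (k + 1)} := by
    intro n t
    simp only [unitMeas]
    rw [Measure.restrict_apply (hB _ t), Measure.restrict_apply (hB _ _),
      ← vol_split _ _ ((hB n (fun k => t (k + 1))).inter measurableSet_Ico) Set.inter_subset_right]
    congr 1
    ext x
    simp only [Set.mem_inter_iff, Set.mem_ofPred_eq, Set.mem_Ico]
    have hsucc : (∀ k < n + 1, digit k x ∈ t k) ↔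
        (digit 0 x ∈ t 0 ∧ ∀ k < n, digit (k + 1) x ∈ t (k + 1)) := by
      constructor
      · intro h; exact ⟨h 0 (by omega), fun k hk => h (k + 1) (by omega)⟩
      · rintro ⟨h0, h1⟩ k hk
        cases k with
        | zero => exact h0
        | succ k => exact h1 k (by omega)
    rw [hsucc]
    have d0 : 0 ≤ 2 * x - 0 → ∀ k, digit (k + 1) x = digit k (2 * x - 0) := fun h k => by
      have := digit_succ_aux (x := x) 0 (by simpa using h) k
      simpa using this
    have d1 : 0 ≤ 2 * x - 1 → ∀ k, digit (k + 1) x = digit k (2 * x - 1) := fun h k => by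
      have := digit_succ_aux (x := x) 1 (by simpa using h) k
      simpa using this
    constructor
    · rintro ⟨⟨h0, h1⟩, h2, h3⟩
      by_cases hx : x < 1 / 2
      · left
        rw [digit_zero_of_lt h2 hx] at h0
        refine ⟨h0, fun k hk => ?_, by linarith, by linarith⟩
        rw [← d0 (by linarith)]; exact h1 k hk
      · right
        rw [digit_zero_of_ge (not_lt.1 hx) h3] at h0
        push Not at hx
        refine ⟨h0, fun k hk => ?_, by linarith, by linarith⟩
        rw [← d1 (by linarith)]; exact h1 k hk
    · rintro (⟨h0, h1, h2, h3⟩ | ⟨h0, h1, h2, h3⟩)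
      · refine ⟨⟨?_, fun k hk => ?_⟩, by linarith, by linarith⟩
        · rw [digit_zero_of_lt (by linarith) (by linarith)]; exact h0
        · rw [d0 h2]; exact h1 k hk
      · refine ⟨⟨?_, fun k hk => ?_⟩, by linarith, by linarith⟩
        · rw [digit_zero_of_ge (by linarith) (by linarith)]; exact h0
        · rw [d1 h2]; exact h1 k hk
  have hfair : ∀ s : Set ℕ, fair s = (if 0 ∈ s then ENNReal.ofReal (1 / 2) else 0) +
      (if 1 ∈ s then ENNReal.ofReal (1 / 2) else 0) := by
    intro s
    have := key 0 (fun _ => s)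
    simp only [not_lt_zero, false_imp_iff, implies_true, Set.ofPred_true, measure_univ, mul_one]
      at this
    rw [← this, fair, Measure.map_apply (measurable_digit 0) (MeasurableSet.of_discrete)]
    congr 1
    ext x
    simp
  induction n generalizing t with
  | zero => simp
  | succ n ih =>
    rw [key, ih (fun k => t (k + 1)), Finset.prod_range_succ', hfair (t 0)]
    ring

lemma map_digits : unitMeas.map (fun x n => digit n x) = Measure.infinitePi (fun _ : ℕ => fair) := by
  have hmeas : Measurable (fun (x : ℝ) (n : ℕ) => digit n x) :=
    measurable_pi_lambda _ measurable_digit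
  refine Measure.eq_infinitePi _ fun s t ht => ?_
  rw [Measure.map_apply hmeas (MeasurableSet.pi s.countable_toSet fun i _ => ht i)]
  set n := s.sup id + 1 with hn
  have hs : ∀ i ∈ s, i < n := fun i hi => Nat.lt_succ_of_le (Finset.le_sup (f := id) hi)
  have := digit_box (fun k => if k ∈ s then t k else Set.univ) n
  have h2 : ∏ k ∈ Finset.range n, fair (if k ∈ s then t k else Set.univ) =
      ∏ k ∈ s, fair (t k) := by
    rw [← Finset.prod_subset (s₁ := s) (s₂ := Finset.range n)]
    · exact Finset.prod_congr rfl fun k hk => by simp [hk]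
    · intro i hi; exact Finset.mem_range.2 (hs i hi)
    · intro i _ hi; simp [hi]
  rw [← h2, ← this]
  congr 1
  ext x
  simp only [Set.mem_preimage, Set.mem_pi, Finset.mem_coe, Set.mem_ofPred_eq]
  constructor
  · intro h k hk
    split_ifs with hks
    · exact h k hks
    · trivial
  · intro h i hi
    have := h i (hs i hi)
    simpa [hi] using this

/-- The occupation status as function of the digits. -/
noncomputable def occ (p : ℝ) (u : ℕ → ℕ) : Bool :=
  if ∑' k : ℕ, (u k : ℝ) / 2 ^ (k + 1) < p then true else false

lemma measurable_occ (p : ℝ) : Measurable (occ p) := by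
  have h1 : Measurable (fun u : ℕ → ℕ => ∑' k : ℕ, (u k : ℝ) / 2 ^ (k + 1)) := by
    have : (fun u : ℕ → ℕ => ∑' k : ℕ, (u k : ℝ) / 2 ^ (k + 1)) =
        fun u => ((∑' k : ℕ, (u k : NNReal) / 2 ^ (k + 1) : NNReal) : ℝ) := by
      ext u
      push_cast
      rfl
    rw [this]
    refine Measurable.coe_nnreal_real (Measurable.nnreal_tsum fun k => ?_)
    have : Measurable (fun m : ℕ => (m : NNReal) / 2 ^ (k + 1)) := measurable_of_countable _
    exact this.comp (measurable_pi_apply k)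
  exact Measurable.ite (measurableSet_lt h1 measurable_const) measurable_const measurable_const

/-- The law of a single bond. -/
noncomputable def bondLaw (p : ℝ) : Measure Bool :=
  (Measure.infinitePi (fun _ : ℕ => fair)).map (occ p)

instance (p : ℝ) : IsProbabilityMeasure (bondLaw p) :=
  Measure.isProbabilityMeasure_map (measurable_occ p).aemeasurable

lemma P_eq (d : ℕ) (p : ℝ) : P d p = Measure.infinitePi (fun _ : Bond d => bondLaw p) := by
  have hmeas : Measurable (fun (x : ℝ) (n : ℕ) => digit n x) :=
    measurable_pi_lambda _ measurable_digit
  have hpair : Function.Injective (fun q : ℕ × ℕ => Nat.pair q.1 q.2) := by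
    rintro ⟨a, b⟩ ⟨c, e⟩ h
    simpa [Nat.pair_eq_pair] using h
  have henc : Function.Injective (enc d) := (exists_injective_nat (Bond d)).choose_spec
  have m1 : Measurable (fun (u : ℕ → ℕ) (q : ℕ × ℕ) => u (Nat.pair q.1 q.2)) :=
    measurable_pi_lambda _ fun q => measurable_pi_apply _
  have m2 : Measurable (MeasurableEquiv.curry ℕ ℕ ℕ) := (MeasurableEquiv.curry ℕ ℕ ℕ).measurable
  have m3 : Measurable (fun (u : ℕ → ℕ → ℕ) (i : ℕ) => occ p (u i)) :=
    measurable_pi_lambda _ fun q => (measurable_occ p).comp (measurable_pi_apply _)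
  have m4 : Measurable (fun (u : ℕ → Bool) (b : Bond d) => u (enc d b)) :=
    measurable_pi_lambda _ fun q => measurable_pi_apply _
  have hc : config d p = (fun (u : ℕ → Bool) (b : Bond d) => u (enc d b)) ∘
      (fun (u : ℕ → ℕ → ℕ) (i : ℕ) => occ p (u i)) ∘ (MeasurableEquiv.curry ℕ ℕ ℕ) ∘
      (fun (u : ℕ → ℕ) (q : ℕ × ℕ) => u (Nat.pair q.1 q.2)) ∘
      (fun (x : ℝ) (n : ℕ) => digit n x) := by
    ext x b
    rfl
  have h0 : P d p = unitMeas.map (config d p) := rfl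
  rw [h0, hc, ← Measure.map_map m4 (m3.comp (m2.comp (m1.comp hmeas))),
    ← Measure.map_map m3 (m2.comp (m1.comp hmeas)),
    ← Measure.map_map m2 (m1.comp hmeas), ← Measure.map_map m1 hmeas, map_digits,
    Measure.map_infinitePi_infinitePi_of_inj (P := fun _ : ℕ => fair) hpair,
    Measure.infinitePi_map_curry (fun _ _ => fair),
    Measure.infinitePi_map_pi (μ := fun _ : ℕ => Measure.infinitePi fun _ : ℕ => fair)
      (f := fun _ => occ p) (fun _ => measurable_occ p)]
  exact Measure.map_infinitePi_infinitePi_of_inj (P := fun _ : ℕ => bondLaw p) henc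

instance (d : ℕ) (p : ℝ) : IsProbabilityMeasure (P d p) := by
  rw [P_eq]; infer_instance

/-- Invariance under injective relabelling of bonds. -/
lemma P_relabel (d : ℕ) (p : ℝ) (σ : Bond d → Bond d) (hσ : Function.Injective σ)
    (E : Set (Config d)) (hE : MeasurableSet E) :
    P d p {ω | (fun b => ω (σ b)) ∈ E} = P d p E := by
  have m : Measurable (fun (ω : Config d) (b : Bond d) => ω (σ b)) :=
    measurable_pi_lambda _ fun q => measurable_pi_apply _
  have h := Measure.map_infinitePi_infinitePi_of_inj (P := fun _ : Bond d => bondLaw p) hσ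
  rw [← P_eq] at h
  have h2 := congrArg (fun μ => μ E) h
  rw [Measure.map_apply m hE] at h2
  exact h2


/-! ### Finite-dimensional tools: independence, FKG and BK -/

/-- The event `E` depends only on the bonds in `F`. -/
def Dep {d : ℕ} (F : Finset (Bond d)) (E : Set (Config d)) : Prop :=
  ∀ ω ω' : Config d, (∀ b ∈ F, ω b = ω' b) → ω ∈ E → ω' ∈ E

lemma Dep.mono {d : ℕ} {F G : Finset (Bond d)} {E : Set (Config d)} (h : Dep F E) (hFG : F ⊆ G) :
    Dep G E := fun ω ω' hb hE => h ω ω' (fun b hbF => hb b (hFG hbF)) hE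

lemma Dep.inter {d : ℕ} {F : Finset (Bond d)} {E E' : Set (Config d)} (h : Dep F E)
    (h' : Dep F E') : Dep F (E ∩ E') :=
  fun ω ω' hb hE => ⟨h ω ω' hb hE.1, h' ω ω' hb hE.2⟩

/-- Extension of a configuration on `F` by vacant bonds. -/
noncomputable def ext {d : ℕ} (F : Finset (Bond d)) (η : F → Bool) : Config d :=
  fun b => if h : b ∈ F then η ⟨b, h⟩ else false

lemma Dep.eq_preimage {d : ℕ} {F : Finset (Bond d)} {E : Set (Config d)} (h : Dep F E) :
    E = F.restrict ⁻¹' {η | ext F η ∈ E} := by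
  ext ω
  constructor
  · intro hω
    exact h ω _ (fun b hb => by simp [ext, hb]) hω
  · intro hω
    exact h _ ω (fun b hb => by simp [ext, hb]) hω

lemma Dep.measurable {d : ℕ} {F : Finset (Bond d)} {E : Set (Config d)} (h : Dep F E) :
    MeasurableSet E := by
  rw [h.eq_preimage]
  exact (Finset.measurable_restrict F) (Set.toFinite _).measurableSet

/-- Weight of a finite configuration. -/
noncomputable def Wt {ι : Type*} [Fintype ι] (g : Bool → ℝ) (η : ι → Bool) : ℝ := ∏ i, g (η i)

lemma prob_eq_sum {d : ℕ} (p : ℝ) {F : Finset (Bond d)} {E : Set (Config d)} (h : Dep F E) :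
    (P d p).real E = ∑ η : F → Bool, Wt (fun c => (bondLaw p).real {c}) η *
      (if ext F η ∈ E then 1 else 0) := by
  have h1 : (P d p).real E =
      (Measure.pi (fun _ : F => bondLaw p)).real {η | ext F η ∈ E} := by
    conv_lhs => rw [h.eq_preimage]
    rw [← map_measureReal_apply (Finset.measurable_restrict F) (Set.toFinite _).measurableSet, P_eq,
      Measure.infinitePi_map_restrict]
  have h2 : {η | ext F η ∈ E} =
      ((Finset.univ.filter (fun η : F → Bool => ext F η ∈ E) : Finset (F → Bool)) :
        Set (F → Bool)) := by
    ext; simp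
  rw [h1, h2, ← sum_measureReal_singleton, Finset.sum_filter]
  refine Finset.sum_congr rfl fun η _ => ?_
  split_ifs
  · simp [Wt, Measure.real, Measure.pi_singleton, ENNReal.toReal_prod]
  · simp

lemma prob_indep {d : ℕ} (p : ℝ) {F G : Finset (Bond d)} {E E' : Set (Config d)} (h : Dep F E)
    (h' : Dep G E') (hFG : Disjoint F G) :
    (P d p).real (E ∩ E') = (P d p).real E * (P d p).real E' := by
  have hi := ProbabilityTheory.iIndepFun_infinitePi (P := fun _ : Bond d => bondLaw p)
    (X := fun _ c => c) (fun _ => measurable_id)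
  rw [← P_eq] at hi
  have h2 := hi.indepFun_finset F G hFG (fun i => measurable_pi_apply i)
  have h3 := h2.measure_inter_preimage_eq_mul {η | ext F η ∈ E} {η | ext G η ∈ E'}
    (Set.toFinite _).measurableSet (Set.toFinite _).measurableSet
  have e1 : (fun (ω : Config d) (i : F) => ω i) ⁻¹' {η | ext F η ∈ E} = E := h.eq_preimage.symm
  have e2 : (fun (ω : Config d) (i : G) => ω i) ⁻¹' {η | ext G η ∈ E'} = E' := h'.eq_preimage.symm
  rw [e1, e2] at h3
  simp [Measure.real, h3]

/-- Increasing event. -/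
def Incr {d : ℕ} (E : Set (Config d)) : Prop :=
  ∀ ω ω' : Config d, (∀ b, ω b = true → ω' b = true) → ω ∈ E → ω' ∈ E

lemma Incr.inter {d : ℕ} {E E' : Set (Config d)} (h : Incr E) (h' : Incr E') : Incr (E ∩ E') :=
  fun ω ω' hb hE => ⟨h ω ω' hb hE.1, h' ω ω' hb hE.2⟩

lemma Wt_sum {ι : Type*} [Fintype ι] [DecidableEq ι] (g : Bool → ℝ) (hg : g true + g false = 1) :
    ∑ η : ι → Bool, Wt g η = 1 := by
  have := Finset.prod_univ_sum (fun _ : ι => (Finset.univ : Finset Bool)) (fun _ c => g c)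
  simp only [Fintype.piFinset_univ] at this
  simp only [Wt]
  rw [← this]
  simp [hg]

lemma bondLaw_sum (p : ℝ) : (bondLaw p).real {true} + (bondLaw p).real {false} = 1 := by
  have : ({true} : Set Bool)ᶜ = {false} := by ext c; cases c <;> simp
  rw [← this, measureReal_add_measureReal_compl (MeasurableSet.singleton _)]
  exact probReal_univ

lemma prob_fkg {d : ℕ} (p : ℝ) {F : Finset (Bond d)} {E E' : Set (Config d)} (h : Dep F E)
    (h' : Dep F E') (hi : Incr E) (hi' : Incr E') :
    (P d p).real E * (P d p).real E' ≤ (P d p).real (E ∩ E') := by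
  rw [prob_eq_sum p h, prob_eq_sum p h', prob_eq_sum p (h.inter h')]
  have hmon : ∀ (E : Set (Config d)), Incr E →
      Monotone (fun η : F → Bool => if ext F η ∈ E then (1 : ℝ) else 0) := by
    intro E hE η η' hη
    dsimp only
    split_ifs with h1 h2
    · exact le_rfl
    · refine absurd (hE _ _ ?_ h1) h2
      intro b hb
      unfold ext at hb ⊢
      split_ifs at hb ⊢ with hbF
      have := hη ⟨b, hbF⟩
      rw [hb] at this
      exact top_le_iff.1 this
    · norm_num
    · exact le_rfl
  have hnn : ∀ (E : Set (Config d)), 0 ≤ (fun η : F → Bool => if ext F η ∈ E then (1 : ℝ) else 0) := by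
    intro E η
    dsimp only
    split_ifs <;> simp
  have := fkg _ _ (Wt (fun c => (bondLaw p).real {c}))
    (fun η => Finset.prod_nonneg fun _ _ => measureReal_nonneg) (hnn E) (hnn E') (hmon E hi)
    (hmon E' hi') (by
      intro a b
      simp only [Wt, ← Finset.prod_mul_distrib]
      refine le_of_eq (Finset.prod_congr rfl fun i _ => ?_)
      simp only [Pi.inf_apply, Pi.sup_apply]
      cases a i <;> cases b i <;> simp [mul_comm])
  rw [Wt_sum _ (bondLaw_sum p), one_mul] at this
  refine this.trans (le_of_eq (Finset.sum_congr rfl fun η _ => ?_))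
  congr 1
  by_cases h1 : ext F η ∈ E <;> by_cases h2 : ext F η ∈ E' <;> simp [h1, h2]

section BK

variable {ι : Type*} [Fintype ι] [DecidableEq ι]

/-- The interpolating event in the proof of the BK inequality. -/
def DD (A B : Set (Set ι)) (T : Finset ι) (x : (ι → Bool) × (ι → Bool)) : Prop :=
  ∃ K ∈ A, ∃ L ∈ B, (∀ i ∈ K, x.1 i = true) ∧
    (∀ i ∈ L, (if i ∈ T then x.2 i else x.1 i) = true) ∧ (∀ i ∈ K, i ∈ L → i ∈ T)

/-- Auxiliary event: a witness using `i` in its first part, off the status of `i`. -/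
def DB (A B : Set (Set ι)) (T : Finset ι) (i : ι) (x : (ι → Bool) × (ι → Bool)) : Prop :=
  ∃ K ∈ A, ∃ L ∈ B, i ∈ K ∧ i ∉ L ∧ (∀ k ∈ K, k ≠ i → x.1 k = true) ∧
    (∀ k ∈ L, k ≠ i → (if k ∈ T then x.2 k else x.1 k) = true) ∧ (∀ k ∈ K, k ∈ L → k ∈ T)

/-- Swap the coordinate `i` between the two copies. -/
def swp (i : ι) (x : (ι → Bool) × (ι → Bool)) : (ι → Bool) × (ι → Bool) :=
  (fun k => if k = i then x.2 k else x.1 k, fun k => if k = i then x.1 k else x.2 k)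

lemma swp_swp (i : ι) (x : (ι → Bool) × (ι → Bool)) : swp i (swp i x) = x := by
  ext k <;> simp only [swp] <;> split_ifs <;> rfl

lemma DB_swp (A B : Set (Set ι)) (T : Finset ι) (i : ι) (x : (ι → Bool) × (ι → Bool)) :
    DB A B T i (swp i x) ↔ DB A B T i x := by
  unfold DB
  have h1 : ∀ k, k ≠ i → (swp i x).1 k = x.1 k := fun k hk => by simp [swp, hk]
  have h2 : ∀ k, k ≠ i → (swp i x).2 k = x.2 k := fun k hk => by simp [swp, hk]
  constructor
  · rintro ⟨K, hK, L, hL, a, b, c, e, f⟩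
    refine ⟨K, hK, L, hL, a, b, fun k hk hki => ?_, fun k hk hki => ?_, f⟩
    · rw [← h1 k hki]; exact c k hk hki
    · rw [← h1 k hki, ← h2 k hki]; exact e k hk hki
  · rintro ⟨K, hK, L, hL, a, b, c, e, f⟩
    refine ⟨K, hK, L, hL, a, b, fun k hk hki => ?_, fun k hk hki => ?_, f⟩
    · rw [h1 k hki]; exact c k hk hki
    · rw [h1 k hki, h2 k hki]; exact e k hk hki

/-- The measure preserving map of the BK step. -/
noncomputable def psi (A B : Set (Set ι)) (T : Finset ι) (i : ι) (x : (ι → Bool) × (ι → Bool)) :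
    (ι → Bool) × (ι → Bool) := if DB A B T i x then x else swp i x

lemma psi_invol (A B : Set (Set ι)) (T : Finset ι) (i : ι) :
    Function.Involutive (psi A B T i) := by
  intro x
  by_cases h : DB A B T i x
  · simp [psi, h]
  · have h' : ¬ DB A B T i (swp i x) := by rwa [DB_swp]
    simp [psi, h, h', swp_swp]

lemma DD_psi (A B : Set (Set ι)) (T : Finset ι) (i : ι) (hi : i ∉ T)
    (x : (ι → Bool) × (ι → Bool)) (h : DD A B T x) : DD A B (insert i T) (psi A B T i x) := by
  obtain ⟨K, hK, L, hL, h1, h2, h3⟩ := h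
  by_cases hb : DB A B T i x
  · have hp : psi A B T i x = x := by simp [psi, hb]
    rw [hp]
    by_cases hiL : i ∈ L
    · have hx : x.1 i = true := by have := h2 i hiL; simpa [hi] using this
      obtain ⟨K', hK', L', hL', a, b, c, e, f⟩ := hb
      refine ⟨K', hK', L', hL', fun k hk => ?_, fun k hk => ?_, fun k hk hk' =>
        Finset.mem_insert_of_mem (f k hk hk')⟩
      · by_cases hki : k = i
        · rw [hki]; exact hx
        · exact c k hk hki
      · have hki : k ≠ i := fun hki => b (hki ▸ hk)
        have := e k hk hki
        simpa [Finset.mem_insert, hki] using this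
    · refine ⟨K, hK, L, hL, h1, fun k hk => ?_, fun k hk hk' =>
        Finset.mem_insert_of_mem (h3 k hk hk')⟩
      have hki : k ≠ i := fun hki => hiL (hki ▸ hk)
      have := h2 k hk
      simpa [Finset.mem_insert, hki] using this
  · have hp : psi A B T i x = swp i x := by simp [psi, hb]
    have hiK : i ∉ K := by
      intro hiK
      exact hb ⟨K, hK, L, hL, hiK, fun hiL => hi (h3 i hiK hiL), fun k hk _ => h1 k hk,
        fun k hk _ => h2 k hk, h3⟩
    rw [hp]
    refine ⟨K, hK, L, hL, fun k hk => ?_, fun k hk => ?_, fun k hk hk' =>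
        Finset.mem_insert_of_mem (h3 k hk hk')⟩
    · have hki : k ≠ i := fun hki => hiK (hki ▸ hk)
      simpa [swp, hki] using h1 k hk
    · by_cases hki : k = i
      · subst hki
        have := h2 k hk
        simpa [swp, hi] using this
      · have := h2 k hk
        simpa [swp, Finset.mem_insert, hki] using this

lemma Wt_psi (g : Bool → ℝ) (A B : Set (Set ι)) (T : Finset ι) (i : ι)
    (x : (ι → Bool) × (ι → Bool)) :
    Wt g (psi A B T i x).1 * Wt g (psi A B T i x).2 = Wt g x.1 * Wt g x.2 := by
  unfold psi
  split_ifs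
  · rfl
  · simp only [Wt, ← Finset.prod_mul_distrib, swp]
    refine Finset.prod_congr rfl fun k _ => ?_
    split_ifs
    · ring
    · rfl

lemma bk_step (g : Bool → ℝ) (hg : ∀ c, 0 ≤ g c) (A B : Set (Set ι)) (T : Finset ι) :
    ∑ x : (ι → Bool) × (ι → Bool), Wt g x.1 * Wt g x.2 * (if DD A B ∅ x then 1 else 0) ≤
    ∑ x : (ι → Bool) × (ι → Bool), Wt g x.1 * Wt g x.2 * (if DD A B T x then 1 else 0) := by
  have hW : ∀ η : ι → Bool, 0 ≤ Wt g η := fun η => Finset.prod_nonneg fun _ _ => hg _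
  induction T using Finset.induction_on with
  | empty => exact le_rfl
  | insert i T hi ih =>
    refine ih.trans ?_
    rw [← Equiv.sum_comp (psi_invol A B T i).toPerm
      (fun x => Wt g x.1 * Wt g x.2 * (if DD A B (insert i T) x then 1 else 0))]
    refine Finset.sum_le_sum fun x _ => ?_
    simp only [Function.Involutive.coe_toPerm]
    rw [Wt_psi]
    refine mul_le_mul_of_nonneg_left ?_ (mul_nonneg (hW _) (hW _))
    by_cases h1 : DD A B T x
    · have h2 := DD_psi A B T i hi x h1
      simp [h1, h2]
    · by_cases h2 : DD A B (insert i T) (psi A B T i x) <;> simp [h1, h2]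

lemma bk_finite (g : Bool → ℝ) (hg : ∀ c, 0 ≤ g c) (hg1 : g true + g false = 1)
    (A B : Set (Set ι)) :
    ∑ η : ι → Bool, Wt g η * (if ∃ K ∈ A, ∃ L ∈ B, (∀ i ∈ K, η i = true) ∧
      (∀ i ∈ L, η i = true) ∧ ∀ i ∈ K, i ∉ L then 1 else 0) ≤
    (∑ η : ι → Bool, Wt g η * (if ∃ K ∈ A, ∀ i ∈ K, η i = true then 1 else 0)) *
    (∑ η : ι → Bool, Wt g η * (if ∃ L ∈ B, ∀ i ∈ L, η i = true then 1 else 0)) := by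
  have h := bk_step g hg A B Finset.univ
  have e1 : ∑ x : (ι → Bool) × (ι → Bool), Wt g x.1 * Wt g x.2 * (if DD A B ∅ x then 1 else 0) =
      ∑ η : ι → Bool, Wt g η * (if ∃ K ∈ A, ∃ L ∈ B, (∀ i ∈ K, η i = true) ∧
      (∀ i ∈ L, η i = true) ∧ ∀ i ∈ K, i ∉ L then 1 else 0) := by
    rw [Fintype.sum_prod_type]
    refine Finset.sum_congr rfl fun η _ => ?_
    simp only [DD, Finset.notMem_empty, if_false, imp_false]
    calc _ = ∑ y : ι → Bool, Wt g y * (Wt g η * (if ∃ K ∈ A, ∃ L ∈ B, (∀ i ∈ K, η i = true) ∧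
      (∀ i ∈ L, η i = true) ∧ ∀ i ∈ K, i ∉ L then 1 else 0)) :=
          Finset.sum_congr rfl fun y _ => by ring
      _ = _ := by rw [← Finset.sum_mul, Wt_sum g hg1, one_mul]
  have e2 : ∑ x : (ι → Bool) × (ι → Bool), Wt g x.1 * Wt g x.2 *
      (if DD A B Finset.univ x then 1 else 0) =
      (∑ η : ι → Bool, Wt g η * (if ∃ K ∈ A, ∀ i ∈ K, η i = true then 1 else 0)) *
      (∑ η : ι → Bool, Wt g η * (if ∃ L ∈ B, ∀ i ∈ L, η i = true then 1 else 0)) := by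
    rw [Finset.sum_mul_sum, Fintype.sum_prod_type]
    refine Finset.sum_congr rfl fun η _ => Finset.sum_congr rfl fun η' _ => ?_
    have : DD A B Finset.univ (η, η') ↔
        (∃ K ∈ A, ∀ i ∈ K, η i = true) ∧ (∃ L ∈ B, ∀ i ∈ L, η' i = true) := by
      unfold DD
      simp only [Finset.mem_univ, if_true, implies_true, and_true]
      constructor
      · rintro ⟨K, hK, L, hL, a, b⟩; exact ⟨⟨K, hK, a⟩, ⟨L, hL, b⟩⟩
      · rintro ⟨⟨K, hK, a⟩, ⟨L, hL, b⟩⟩; exact ⟨K, hK, L, hL, a, b⟩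
    rw [if_congr this rfl rfl, ite_and]
    split_ifs <;> ring
  rw [e1, e2] at h
  exact h

end BK

/-- The BK inequality for events given by families of witness sets inside `F`. -/
lemma prob_bk {d : ℕ} (p : ℝ) (F : Finset (Bond d)) (A B : Set (Set (Bond d)))
    (hA : ∀ K ∈ A, K ⊆ F) (hB : ∀ K ∈ B, K ⊆ F) :
    (P d p).real {ω | ∃ K ∈ A, ∃ L ∈ B, (∀ b ∈ K, ω b = true) ∧ (∀ b ∈ L, ω b = true) ∧
      ∀ b ∈ K, b ∉ L} ≤
    (P d p).real {ω | ∃ K ∈ A, ∀ b ∈ K, ω b = true} *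
      (P d p).real {ω | ∃ L ∈ B, ∀ b ∈ L, ω b = true} := by
  have dA : ∀ A : Set (Set (Bond d)), (∀ K ∈ A, K ⊆ F) →
      Dep F {ω | ∃ K ∈ A, ∀ b ∈ K, ω b = true} := by
    rintro A hA ω ω' hb ⟨K, hK, h⟩
    exact ⟨K, hK, fun b hbK => by rw [← hb b (hA K hK hbK)]; exact h b hbK⟩
  have dAB : Dep F {ω | ∃ K ∈ A, ∃ L ∈ B, (∀ b ∈ K, ω b = true) ∧ (∀ b ∈ L, ω b = true) ∧
      ∀ b ∈ K, b ∉ L} := by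
    rintro ω ω' hb ⟨K, hK, L, hL, h1, h2, h3⟩
    exact ⟨K, hK, L, hL, fun b hbK => by rw [← hb b (hA K hK hbK)]; exact h1 b hbK,
      fun b hbK => by rw [← hb b (hB L hL hbK)]; exact h2 b hbK, h3⟩
  have trans : ∀ (A : Set (Set (Bond d))) (η : F → Bool), (∀ K ∈ A, K ⊆ F) →
      ((∃ K ∈ A, ∀ b ∈ K, ext F η b = true) ↔
        ∃ K ∈ (fun K : Set (Bond d) => ((↑) : F → Bond d) ⁻¹' K) '' A, ∀ b ∈ K, η b = true) := by
    intro A η hA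
    constructor
    · rintro ⟨K, hK, h⟩
      refine ⟨_, ⟨K, hK, rfl⟩, fun b hb => ?_⟩
      have := h b hb
      simpa [ext] using this
    · rintro ⟨_, ⟨K, hK, rfl⟩, h⟩
      refine ⟨K, hK, fun b hb => ?_⟩
      have hbF : b ∈ F := hA K hK hb
      have := h ⟨b, hbF⟩ hb
      simpa [ext, hbF] using this
  rw [prob_eq_sum p dAB, prob_eq_sum p (dA A hA), prob_eq_sum p (dA B hB)]
  have := bk_finite (ι := F) (fun c => (bondLaw p).real {c}) (fun _ => measureReal_nonneg)
    (bondLaw_sum p) ((fun K : Set (Bond d) => ((↑) : F → Bond d) ⁻¹' K) '' A)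
    ((fun K : Set (Bond d) => ((↑) : F → Bond d) ⁻¹' K) '' B)
  refine le_trans (le_of_eq ?_) (this.trans (le_of_eq ?_))
  · refine Finset.sum_congr rfl fun η _ => ?_
    congr 1
    refine if_congr ?_ rfl rfl
    constructor
    · rintro ⟨K, hK, L, hL, h1, h2, h3⟩
      refine ⟨_, ⟨K, hK, rfl⟩, _, ⟨L, hL, rfl⟩, fun b hb => ?_, fun b hb => ?_, fun b hb => h3 b hb⟩
      · simpa [ext] using h1 b hb
      · simpa [ext] using h2 b hb
    · rintro ⟨_, ⟨K, hK, rfl⟩, _, ⟨L, hL, rfl⟩, h1, h2, h3⟩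
      refine ⟨K, hK, L, hL, fun b hb => ?_, fun b hb => ?_, fun b hb => ?_⟩
      · have hbF : b ∈ F := hA K hK hb
        simpa [ext, hbF] using h1 ⟨b, hbF⟩ hb
      · have hbF : b ∈ F := hB L hL hb
        simpa [ext, hbF] using h2 ⟨b, hbF⟩ hb
      · exact h3 ⟨b, hA K hK hb⟩ hb
  · congr 1
    · refine Finset.sum_congr rfl fun η _ => ?_
      congr 1
      exact if_congr (trans A η hA).symm rfl rfl
    · refine Finset.sum_congr rfl fun η _ => ?_
      congr 1
      exact if_congr (trans B η hB).symm rfl rfl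


/-! ### Paths in dimension one -/

/-- The bond from `(a, s)` to `(b, s + 1)`. -/
def bd (a : ℤ) (s : ℕ) (b : ℤ) : Bond 1 := ((fun _ => a, s), fun _ => b)

/-- `π` makes nearest-neighbour steps between times `s` and `u`. -/
def Stp (π : ℕ → ℤ) (s u : ℕ) : Prop := ∀ k, s ≤ k → k < u → |π (k + 1) - π k| = 1

/-- The bonds used by `π` between times `s` and `u`. -/
def bds (π : ℕ → ℤ) (s u : ℕ) : Set (Bond 1) :=
  {b | ∃ k, s ≤ k ∧ k < u ∧ b = bd (π k) k (π (k + 1))}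

/-- Bond sets of the nearest-neighbour paths satisfying `Q`. -/
def fam (Q : (ℕ → ℤ) → ℕ → ℕ → Prop) : Set (Set (Bond 1)) :=
  {K | ∃ π s u, Q π s u ∧ Stp π s u ∧ K = bds π s u}

/-- The event that some path satisfying `Q` is open. -/
def Ev (Q : (ℕ → ℤ) → ℕ → ℕ → Prop) : Set (Config 1) :=
  {ω | ∃ K ∈ fam Q, ∀ b ∈ K, ω b = true}

lemma bd_inj {a b a' b' : ℤ} {s s' : ℕ} (h : bd a s b = bd a' s' b') : a = a' ∧ s = s' ∧ b = b' := by
  simp only [bd, Prod.mk.injEq] at h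
  exact ⟨congrFun h.1.1 0, h.1.2, congrFun h.2 0⟩

lemma mem_Ev {Q : (ℕ → ℤ) → ℕ → ℕ → Prop} {ω : Config 1} :
    ω ∈ Ev Q ↔ ∃ π s u, Q π s u ∧ Stp π s u ∧
      ∀ k, s ≤ k → k < u → ω (bd (π k) k (π (k + 1))) = true := by
  constructor
  · rintro ⟨K, ⟨π, s, u, hQ, hS, rfl⟩, h⟩
    exact ⟨π, s, u, hQ, hS, fun k h1 h2 => h _ ⟨k, h1, h2, rfl⟩⟩
  · rintro ⟨π, s, u, hQ, hS, h⟩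
    refine ⟨_, ⟨π, s, u, hQ, hS, rfl⟩, ?_⟩
    rintro _ ⟨k, h1, h2, rfl⟩
    exact h k h1 h2

lemma Ev_incr (Q : (ℕ → ℤ) → ℕ → ℕ → Prop) : Incr (Ev Q) := by
  rintro ω ω' h ⟨K, hK, h1⟩
  exact ⟨K, hK, fun b hb => h b (h1 b hb)⟩

lemma Ev_mono {Q Q' : (ℕ → ℤ) → ℕ → ℕ → Prop} (h : ∀ π s u, Q π s u → Q' π s u) :
    Ev Q ⊆ Ev Q' := by
  rintro ω ⟨K, ⟨π, s, u, hQ, hS, rfl⟩, h1⟩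
  exact ⟨_, ⟨π, s, u, h _ _ _ hQ, hS, rfl⟩, h1⟩

/-- All the bonds of the paths satisfying `Q` lie in `F`. -/
def Sup (F : Finset (Bond 1)) (Q : (ℕ → ℤ) → ℕ → ℕ → Prop) : Prop :=
  ∀ π s u, Q π s u → Stp π s u → ∀ k, s ≤ k → k < u → bd (π k) k (π (k + 1)) ∈ F

lemma Sup.fam {F : Finset (Bond 1)} {Q : (ℕ → ℤ) → ℕ → ℕ → Prop} (h : Sup F Q) :
    ∀ K ∈ fam Q, K ⊆ F := by
  rintro K ⟨π, s, u, hQ, hS, rfl⟩ b ⟨k, h1, h2, rfl⟩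
  exact h π s u hQ hS k h1 h2

lemma Sup.dep {F : Finset (Bond 1)} {Q : (ℕ → ℤ) → ℕ → ℕ → Prop} (h : Sup F Q) :
    Dep F (Ev Q) := by
  rintro ω ω' hb ⟨K, hK, h1⟩
  exact ⟨K, hK, fun b hbK => by rw [← hb b (h.fam K hK hbK)]; exact h1 b hbK⟩

lemma relabel_le (p : ℝ) {F : Finset (Bond 1)} {Q Q' : (ℕ → ℤ) → ℕ → ℕ → Prop} (hF : Sup F Q)
    (σ : Bond 1 → Bond 1) (hσ : Function.Injective σ)
    (h : ∀ π s u, Q' π s u → Stp π s u → ∃ π' s' u', Q π' s' u' ∧ Stp π' s' u' ∧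
      ∀ k, s' ≤ k → k < u' → ∃ l, s ≤ l ∧ l < u ∧
        σ (bd (π' k) k (π' (k + 1))) = bd (π l) l (π (l + 1))) :
    (P 1 p).real (Ev Q') ≤ (P 1 p).real (Ev Q) := by
  have h1 : (P 1 p).real (Ev Q) = (P 1 p).real {ω | (fun b => ω (σ b)) ∈ Ev Q} := by
    simp only [Measure.real]
    rw [P_relabel 1 p σ hσ _ hF.dep.measurable]
  rw [h1]
  refine measureReal_mono ?_
  intro ω hω
  obtain ⟨π, s, u, hQ, hS, ho⟩ := mem_Ev.1 hω
  obtain ⟨π', s', u', hQ', hS', hb⟩ := h π s u hQ hS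
  refine mem_Ev.2 ⟨π', s', u', hQ', hS', fun k h1 h2 => ?_⟩
  obtain ⟨l, l1, l2, hl⟩ := hb k h1 h2
  simp only [hl]
  exact ho l l1 l2

/-- A finite box of bonds. -/
noncomputable def box (N : ℕ) : Finset (Bond 1) :=
  ((Finset.Icc (-(N : ℤ)) N ×ˢ Finset.range N) ×ˢ Finset.Icc (-(N : ℤ)) N).image
    fun q => bd q.1.1 q.1.2 q.2

lemma mem_box {N : ℕ} {a b : ℤ} {s : ℕ} (h1 : |a| ≤ N) (h2 : s < N) (h3 : |b| ≤ N) :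
    bd a s b ∈ box N := by
  rw [box, Finset.mem_image]
  refine ⟨((a, s), b), ?_, rfl⟩
  simp only [Finset.mem_product, Finset.mem_Icc, Finset.mem_range]
  exact ⟨⟨abs_le.1 h1, h2⟩, abs_le.1 h3⟩

/-- The bonds of a box whose leftmost column is in `[l, r)`. -/
noncomputable def colF (N : ℕ) (l r : ℤ) : Finset (Bond 1) :=
  (box N).filter fun b => l ≤ min (b.1.1 0) (b.2 0) ∧ min (b.1.1 0) (b.2 0) < r

/-- The bonds of a box with time in `[l, r)`. -/
noncomputable def timF (N : ℕ) (l r : ℕ) : Finset (Bond 1) :=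
  (box N).filter fun b => l ≤ b.1.2 ∧ b.1.2 < r

lemma Stp.sub {π : ℕ → ℤ} {s u s' u' : ℕ} (h : Stp π s u) (h1 : s ≤ s') (h2 : u' ≤ u) :
    Stp π s' u' := fun k a b => h k (h1.trans a) (b.trans_le h2)

lemma Stp.abs {π : ℕ → ℤ} {s u : ℕ} (h : Stp π s u) {k l : ℕ} (h1 : s ≤ k) (h2 : k ≤ l)
    (h3 : l ≤ u) : |π l - π k| ≤ (l : ℤ) - k := by
  induction l, h2 using Nat.le_induction with
  | base => simp
  | succ l hl ih =>
    have := ih (by omega)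
    have h4 := h l (by omega) (by omega)
    rw [abs_le] at *
    have := abs_le.1 h4.le
    push_cast
    omega

lemma Stp.neg {π : ℕ → ℤ} {s u : ℕ} (h : Stp π s u) : Stp (fun k => - π k) s u := by
  intro k h1 h2
  rw [← h k h1 h2, ← abs_neg]
  congr 1
  ring

/-! Connection with `ConnectedIn`. -/

lemma norm1_one (x : Fin 1 → ℤ) : norm1 x = |x 0| := by simp [norm1]

lemma conn_of_path {ω : Config 1} {R : Set ((Fin 1 → ℤ) × ℕ)} {π : ℕ → ℤ} {s u : ℕ} (hsu : s ≤ u)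
    (hS : Stp π s u) (ho : ∀ k, s ≤ k → k < u → ω (bd (π k) k (π (k + 1))) = true)
    (hR : ∀ k, s ≤ k → k ≤ u → ((fun _ => π k : Fin 1 → ℤ), k) ∈ R) :
    ConnectedIn ω R (fun _ => π s) s (fun _ => π u) u := by
  rcases hsu.eq_or_lt with rfl | h
  · exact Or.inl ⟨rfl, rfl, hR s le_rfl le_rfl⟩
  · refine Or.inr ⟨h, fun k _ => π k, rfl, rfl, hR, fun k h1 h2 => ⟨?_, ho k h1 h2⟩⟩
    rw [norm1_one]
    exact hS k h1 h2

lemma path_of_conn {ω : Config 1} {R : Set ((Fin 1 → ℤ) × ℕ)} {x y : Fin 1 → ℤ} {s u : ℕ}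
    (h : ConnectedIn ω R x s y u) :
    s ≤ u ∧ ∃ π : ℕ → ℤ, π s = x 0 ∧ π u = y 0 ∧ Stp π s u ∧
      (∀ k, s ≤ k → k < u → ω (bd (π k) k (π (k + 1))) = true) ∧
      ∀ k, s ≤ k → k ≤ u → ((fun _ => π k : Fin 1 → ℤ), k) ∈ R := by
  have e : ∀ z : Fin 1 → ℤ, (fun _ => z 0) = z := by
    intro z; ext i; fin_cases i; rfl
  rcases h with ⟨rfl, rfl, hR⟩ | ⟨hsu, v, hs, hu, hR, hv⟩
  · refine ⟨le_rfl, fun _ => x 0, rfl, rfl, fun k h1 h2 => by omega, fun k h1 h2 => by omega, ?_⟩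
    intro k h1 h2
    obtain rfl : k = s := by omega
    rwa [e]
  · refine ⟨hsu.le, fun k => v k 0, by simp [hs], by simp [hu], fun k h1 h2 => ?_,
      fun k h1 h2 => ?_, fun k h1 h2 => ?_⟩
    · have := (hv k h1 h2).1
      rwa [norm1_one] at this
    · simp only [bd, e]
      exact (hv k h1 h2).2
    · rw [e]; exact hR k h1 h2

/-! Combinatorics of paths. -/

lemma meet {f g : ℕ → ℤ} {s u : ℕ} (hsu : s ≤ u) (hf : Stp f s u) (hg : Stp g s u)
    (he : Even (f s - g s)) (h1 : f s ≤ g s) (h2 : g u ≤ f u) :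
    ∃ k, s ≤ k ∧ k ≤ u ∧ f k = g k := by
  have hev : ∀ k, s ≤ k → k ≤ u → Even (f k - g k) := by
    intro k hk
    induction k, hk using Nat.le_induction with
    | base => exact fun _ => he
    | succ k hk ih =>
      intro hku
      have a := ih (by omega)
      have b := hf k hk (by omega)
      have c := hg k hk (by omega)
      rw [Int.even_iff] at *
      rcases (abs_eq (by norm_num)).1 b with b | b <;>
        rcases (abs_eq (by norm_num)).1 c with c | c <;> omega
  have hex : ∃ k, s ≤ k ∧ g k ≤ f k := ⟨u, hsu, h2⟩
  obtain ⟨a, b⟩ := Nat.find_spec hex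
  have hle : Nat.find hex ≤ u := Nat.find_min' hex ⟨hsu, h2⟩
  have hmin := fun m => @Nat.find_min _ _ hex m
  generalize Nat.find hex = k at a b hle hmin
  refine ⟨k, a, hle, ?_⟩
  rcases a.eq_or_lt with rfl | a'
  · omega
  · obtain ⟨l, rfl⟩ : ∃ l, k = l + 1 := ⟨k - 1, by omega⟩
    have m := hmin l (by omega)
    have m' : f l < g l := by
      by_contra hc
      exact m ⟨by omega, by omega⟩
    have e1 := hev l (by omega) (by omega)
    have b1 := hf l (by omega) (by omega)
    have c1 := hg l (by omega) (by omega)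
    rw [Int.even_iff] at e1
    rcases (abs_eq (by norm_num)).1 b1 with b1 | b1 <;>
        rcases (abs_eq (by norm_num)).1 c1 with c1 | c1 <;> omega

lemma first_hit {f : ℕ → ℤ} {k u : ℕ} {a : ℤ} (hku : k ≤ u) (hf : Stp f k u) (h1 : a < f k)
    (h2 : f u ≤ a) : ∃ v, k < v ∧ v ≤ u ∧ f v = a ∧ ∀ i, k ≤ i → i < v → a < f i := by
  have hex : ∃ v, k ≤ v ∧ f v ≤ a := ⟨u, hku, h2⟩
  obtain ⟨c, b⟩ := Nat.find_spec hex
  have hle : Nat.find hex ≤ u := Nat.find_min' hex ⟨hku, h2⟩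
  have hmin := fun m => @Nat.find_min _ _ hex m
  generalize Nat.find hex = v at c b hle hmin
  have hkv : k < v := by
    rcases c.eq_or_lt with rfl | c
    · omega
    · exact c
  have hm : ∀ i, k ≤ i → i < v → a < f i := by
    intro i hi hiv
    by_contra hc
    exact hmin i hiv ⟨hi, by omega⟩
  refine ⟨v, hkv, hle, ?_, hm⟩
  obtain ⟨l, rfl⟩ : ∃ l, v = l + 1 := ⟨v - 1, by omega⟩
  have m := hm l (by omega) (by omega)
  have := abs_le.1 (hf l (by omega) (by omega)).le
  omega

lemma last_hit {f : ℕ → ℤ} {k u : ℕ} {b : ℤ} (hku : k ≤ u) (hf : Stp f k u) (h1 : b ≤ f k)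
    (h2 : f u < b) : ∃ v, k ≤ v ∧ v < u ∧ f v = b ∧ ∀ i, v < i → i ≤ u → f i < b := by
  induction u, hku using Nat.le_induction with
  | base => omega
  | succ u hu ih =>
    by_cases hb : f u < b
    · obtain ⟨v, a1, a2, a3, a4⟩ := ih (hf.sub le_rfl (by omega)) hb
      refine ⟨v, a1, by omega, a3, fun i hi hi' => ?_⟩
      rcases Nat.lt_or_ge u i with h | h
      · obtain rfl : i = u + 1 := by omega
        exact h2
      · exact a4 i hi h
    · refine ⟨u, hu, by omega, ?_, fun i hi hi' => ?_⟩
      · have := abs_le.1 (hf u (by omega) (by omega)).le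
        omega
      · obtain rfl : i = u + 1 := by omega
        exact h2

lemma crossing_down {f : ℕ → ℤ} {k u : ℕ} {a b : ℤ} (hku : k ≤ u) (hf : Stp f k u) (hab : a < b)
    (h1 : b ≤ f k) (h2 : f u ≤ a) :
    ∃ s v, k ≤ s ∧ s ≤ v ∧ v ≤ u ∧ f s = b ∧ f v = a ∧ ∀ i, s ≤ i → i ≤ v → a ≤ f i ∧ f i ≤ b := by
  obtain ⟨v, v1, v2, v3, v4⟩ := first_hit hku hf (by omega) h2
  obtain ⟨s, s1, s2, s3, s4⟩ := last_hit v1.le (hf.sub le_rfl v2) h1 (by omega)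
  refine ⟨s, v, s1, s2.le, v2, s3, v3, fun i hi hi' => ⟨?_, ?_⟩⟩
  · rcases hi'.eq_or_lt with rfl | h
    · omega
    · exact (v4 i (by omega) h).le
  · rcases hi.eq_or_lt with rfl | h
    · omega
    · exact (s4 i h hi').le

lemma crossing_up {f : ℕ → ℤ} {k u : ℕ} {a b : ℤ} (hku : k ≤ u) (hf : Stp f k u) (hab : a < b)
    (h1 : f k ≤ a) (h2 : b ≤ f u) :
    ∃ s v, k ≤ s ∧ s ≤ v ∧ v ≤ u ∧ f s = a ∧ f v = b ∧ ∀ i, s ≤ i → i ≤ v → a ≤ f i ∧ f i ≤ b := by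
  obtain ⟨s, v, a1, a2, a3, a4, a5, a6⟩ := crossing_down (a := -b) (b := -a) hku hf.neg (by omega)
    (by omega) (by omega)
  refine ⟨s, v, a1, a2, a3, by omega, by omega, fun i hi hi' => ?_⟩
  have := a6 i hi hi'
  omega

/-! ### The events -/

/-- Survival up to time `t`. -/
def QS (t : ℕ) (π : ℕ → ℤ) (s u : ℕ) : Prop := s = 0 ∧ u = t ∧ π 0 = 0

/-- The origin reaches the column `c` before time `t`. -/
def QR (c : ℤ) (t : ℕ) (π : ℕ → ℤ) (s u : ℕ) : Prop := s = 0 ∧ u ≤ t ∧ π 0 = 0 ∧ π u = c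

/-- Vertical crossing of `[a,b] × [m, m + t]` from an even vertex. -/
def QW (a b : ℤ) (t m : ℕ) (π : ℕ → ℤ) (s u : ℕ) : Prop :=
  s = m ∧ u = m + t ∧ Even (π m) ∧ ∀ k, m ≤ k → k ≤ m + t → a ≤ π k ∧ π k ≤ b

/-- Horizontal crossing of `[a,b] × [0,T]`. -/
def QH (a b : ℤ) (T : ℕ) (π : ℕ → ℤ) (s u : ℕ) : Prop :=
  s ≤ u ∧ u ≤ T ∧ (∀ k, s ≤ k → k ≤ u → a ≤ π k ∧ π k ≤ b) ∧
    ((π s = a ∧ π u = b) ∨ (π s = b ∧ π u = a))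

/-- The origin reaches the column `w` from the left. -/
def Q1 (w : ℤ) (t : ℕ) (π : ℕ → ℤ) (s u : ℕ) : Prop :=
  s = 0 ∧ u ≤ t ∧ π 0 = 0 ∧ π u = w ∧ ∀ k, k ≤ u → π k ≤ w

/-- `(x, t)` is reached from the column `x - w`. -/
def Q3 (w x : ℤ) (t : ℕ) (π : ℕ → ℤ) (s u : ℕ) : Prop :=
  u = t ∧ s ≤ t ∧ π s = x - w ∧ π t = x ∧ ∀ k, s ≤ k → k ≤ t → x - w ≤ π k

lemma sup_QS (t : ℕ) : Sup (box t) (QS t) := by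
  rintro π s u ⟨rfl, rfl, h0⟩ hS k h1 h2
  have a := abs_le.1 (hS.abs le_rfl h1 h2.le)
  have b := abs_le.1 (hS.abs le_rfl (l := k + 1) (by omega) h2)
  push_cast at a b
  exact mem_box (abs_le.2 (by omega)) h2 (abs_le.2 (by omega))

lemma sup_QR (c : ℤ) (t : ℕ) : Sup (box t) (QR c t) := by
  rintro π s u ⟨rfl, hu, h0, -⟩ hS k h1 h2
  have a := abs_le.1 (hS.abs le_rfl h1 h2.le)
  have b := abs_le.1 (hS.abs le_rfl (l := k + 1) (by omega) h2)
  push_cast at a b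
  exact mem_box (abs_le.2 (by omega)) (by omega) (abs_le.2 (by omega))

lemma sup_QW (a b : ℤ) (t m N : ℕ) (ha : -(N : ℤ) ≤ a) (hb : b ≤ N) (hN : m + t ≤ N) :
    Sup (timF N m (m + t)) (QW a b t m) := by
  rintro π s u ⟨rfl, rfl, h0, h⟩ hS k h1 h2
  have := h k h1 h2.le
  have := h (k + 1) (by omega) h2
  rw [timF, Finset.mem_filter]
  exact ⟨mem_box (abs_le.2 (by omega)) (by omega) (abs_le.2 (by omega)), h1, h2⟩

lemma sup_QH (a b : ℤ) (T N : ℕ) (ha : -(N : ℤ) ≤ a) (hb : b ≤ N) (hN : T ≤ N) :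
    Sup (colF N a b) (QH a b T) := by
  rintro π s u ⟨hsu, hu, h, -⟩ hS k h1 h2
  have h3 := h k h1 h2.le
  have h4 := h (k + 1) (by omega) h2
  have h5 := hS k h1 h2
  rw [colF, Finset.mem_filter]
  refine ⟨mem_box (abs_le.2 (by omega)) (by omega) (abs_le.2 (by omega)), ?_⟩
  simp only [bd]
  rcases (abs_eq (by norm_num)).1 h5 with h5 | h5 <;> omega

lemma sup_Q1 (w : ℤ) (t N : ℕ) (hN : t ≤ N) : Sup (colF N (-N) w) (Q1 w t) := by
  rintro π s u ⟨rfl, hu, h0, -, h⟩ hS k h1 h2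
  have a := abs_le.1 (hS.abs le_rfl h1 h2.le)
  have b := abs_le.1 (hS.abs le_rfl (l := k + 1) (by omega) h2)
  push_cast at a b
  have h3 := h k h2.le
  have h4 := h (k + 1) h2
  have h5 := hS k h1 h2
  rw [colF, Finset.mem_filter]
  refine ⟨mem_box (abs_le.2 (by omega)) (by omega) (abs_le.2 (by omega)), ?_⟩
  simp only [bd]
  rcases (abs_eq (by norm_num)).1 h5 with h5 | h5 <;> omega

lemma sup_Q3 (w x : ℤ) (t N : ℕ) (hN : |x| + t + 1 ≤ N) : Sup (colF N (x - w) N) (Q3 w x t) := by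
  rintro π s u ⟨rfl, hs, h0, hx, h⟩ hS k h1 h2
  have a := abs_le.1 (hS.abs h1 h2.le le_rfl)
  have b := abs_le.1 (hS.abs (k := k + 1) (by omega) h2 le_rfl)
  push_cast at a b
  have h3 := h k h1 h2.le
  have h4 := h (k + 1) (by omega) h2
  have h6 := neg_abs_le x
  have h7 := le_abs_self x
  rw [colF, Finset.mem_filter]
  refine ⟨mem_box (abs_le.2 (by omega)) (by omega) (abs_le.2 (by omega)), ?_⟩
  simp only [bd]
  omega

lemma colF_mono {N : ℕ} {l r l' r' : ℤ} (h1 : l' ≤ l) (h2 : r ≤ r') : colF N l r ⊆ colF N l' r' := by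
  intro b
  simp only [colF, Finset.mem_filter]
  rintro ⟨a, c, d⟩
  exact ⟨a, h1.trans c, d.trans_le h2⟩

lemma colF_disj {N : ℕ} {l r l' r' : ℤ} (h : r ≤ l') : Disjoint (colF N l r) (colF N l' r') := by
  rw [Finset.disjoint_left]
  intro b
  simp only [colF, Finset.mem_filter]
  rintro ⟨a, c, d⟩ ⟨-, e, -⟩
  omega

lemma timF_disj {N : ℕ} {l r l' r' : ℕ} (h : r ≤ l') : Disjoint (timF N l r) (timF N l' r') := by
  rw [Finset.disjoint_left]
  intro b
  simp only [timF, Finset.mem_filter]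
  rintro ⟨a, c, d⟩ ⟨-, e, -⟩
  omega

/-! Symmetries. -/

/-- Spatial reflection of bonds. -/
def refl (b : Bond 1) : Bond 1 := ((fun i => - b.1.1 i, b.1.2), fun i => - b.2 i)

lemma refl_inj : Function.Injective refl := by
  have : Function.Involutive refl := by
    rintro ⟨⟨x, s⟩, y⟩; simp [refl]
  exact this.injective

/-- Space-time translation of bonds. -/
def shft (c : ℤ) (m : ℕ) (b : Bond 1) : Bond 1 :=
  ((fun i => b.1.1 i + c, b.1.2 + m), fun i => b.2 i + c)

lemma shft_inj (c : ℤ) (m : ℕ) : Function.Injective (shft c m) := by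
  rintro ⟨⟨x, s⟩, y⟩ ⟨⟨x', s'⟩, y'⟩ h
  simp only [shft, Prod.mk.injEq, funext_iff, add_left_inj] at h
  simp only [Prod.mk.injEq, funext_iff]
  exact h

/-- Time reversal about `(x, t)`. -/
def revb (x : ℤ) (t : ℕ) (b : Bond 1) : Bond 1 :=
  if b.1.2 < t then ((fun i => x - b.2 i, t - 1 - b.1.2), fun i => x - b.1.1 i) else b

lemma revb_inj (x : ℤ) (t : ℕ) : Function.Injective (revb x t) := by
  have : Function.Involutive (revb x t) := by
    rintro ⟨⟨y, s⟩, z⟩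
    by_cases h : s < t
    · have h1 : t - 1 - s < t := by omega
      have h2 : t - 1 - (t - 1 - s) = s := by omega
      simp [revb, h, h1, h2]
    · simp [revb, h]
  exact this.injective

lemma prob_QR_neg (p : ℝ) (c : ℤ) (t : ℕ) :
    (P 1 p).real (Ev (QR (-c) t)) ≤ (P 1 p).real (Ev (QR c t)) := by
  refine relabel_le p (sup_QR c t) refl refl_inj ?_
  rintro π s u ⟨rfl, hu, h0, h1⟩ hS
  refine ⟨fun k => - π k, 0, u, ⟨rfl, hu, by simp [h0], by simp [h1]⟩, hS.neg, fun k a b =>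
    ⟨k, a, b, ?_⟩⟩
  simp [refl, bd]

lemma prob_QW_neg (p : ℝ) (w : ℕ) (t : ℕ) :
    (P 1 p).real (Ev (QW 0 w t 0)) ≤ (P 1 p).real (Ev (QW (-w) 0 t 0)) := by
  refine relabel_le p (sup_QW (-w) 0 t 0 (w + t) (by omega) (by omega) (by omega)) refl refl_inj ?_
  rintro π s u ⟨rfl, rfl, h0, h1⟩ hS
  refine ⟨fun k => - π k, 0, 0 + t, ⟨rfl, rfl, by simpa using h0, fun k a b => ?_⟩, hS.neg,
    fun k a b => ⟨k, a, b, ?_⟩⟩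
  · have := h1 k a b
    dsimp only
    omega
  · simp [refl, bd]

lemma prob_QW_shift (p : ℝ) (w : ℕ) (t m : ℕ) :
    (P 1 p).real (Ev (QW 0 w t m)) ≤ (P 1 p).real (Ev (QW 0 w t 0)) := by
  refine relabel_le p (sup_QW 0 w t 0 (w + t) (by omega) (by omega) (by omega)) (shft 0 m)
    (shft_inj 0 m) ?_
  rintro π s u ⟨rfl, rfl, h0, h1⟩ hS
  refine ⟨fun k => π (k + s), 0, 0 + t, ⟨rfl, rfl, by simpa using h0, fun k a b => ?_⟩,
    fun k a b => ?_, fun k a b => ⟨k + s, by omega, by omega, ?_⟩⟩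
  · exact h1 (k + s) (by omega) (by omega)
  · have := hS (k + s) (by omega) (by omega)
    dsimp only
    rwa [show k + 1 + s = k + s + 1 by omega]
  · simp [shft, bd, show k + 1 + s = k + s + 1 by omega]

lemma prob_QH_shift (p : ℝ) (c : ℤ) (w : ℕ) (t T : ℕ) (hT : t ≤ T) :
    (P 1 p).real (Ev (QH c (c + w) t)) ≤ (P 1 p).real (Ev (QH 0 w T)) := by
  refine relabel_le p (sup_QH 0 w T (w + T) (by omega) (by omega) (by omega)) (shft c 0)
    (shft_inj c 0) ?_
  rintro π s u ⟨hsu, hu, h, h1⟩ hS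
  refine ⟨fun k => π k - c, s, u, ⟨hsu, hu.trans hT, fun k a b => ?_, ?_⟩, fun k a b => ?_,
    fun k a b => ⟨k, a, b, ?_⟩⟩
  · have := h k a b
    dsimp only
    omega
  · dsimp only; omega
  · have := hS k a b
    rw [← this]; congr 1; ring
  · simp [shft, bd]

lemma prob_Q3 (p : ℝ) (w x : ℤ) (t : ℕ) :
    (P 1 p).real (Ev (Q3 w x t)) ≤ (P 1 p).real (Ev (QR w t)) := by
  refine relabel_le p (sup_QR w t) (revb x t) (revb_inj x t) ?_
  rintro π s u ⟨rfl, hs, h0, h1, -⟩ hS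
  refine ⟨fun k => x - π (u - k), 0, u - s, ⟨rfl, by omega, by simp [h1], ?_⟩, fun k a b => ?_,
    fun k a b => ⟨u - 1 - k, by omega, by omega, ?_⟩⟩
  · dsimp only
    rw [show u - (u - s) = s by omega]; omega
  · have := hS (u - (k + 1)) (by omega) (by omega)
    rw [show u - (k + 1) + 1 = u - k by omega] at this
    rw [← this]; congr 1; ring
  · have hk : k < u := by omega
    simp only [revb, bd, hk, if_true]
    rw [show u - 1 - k + 1 = u - k by omega, show u - (k + 1) = u - 1 - k by omega]
    simp

lemma prob_Q1 (p : ℝ) (w : ℤ) (t : ℕ) :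
    (P 1 p).real (Ev (Q1 w t)) ≤ (P 1 p).real (Ev (QR w t)) :=
  measureReal_mono (Ev_mono fun π s u ⟨a, b, c, d, _⟩ => ⟨a, b, c, d⟩)

/-! Relation with the quantities in the statement. -/

lemma prob_QS_le (p : ℝ) (t : ℕ) : (P 1 p).real (Ev (QS t)) ≤ theta 1 p t := by
  refine measureReal_mono ?_
  intro ω hω
  obtain ⟨π, s, u, ⟨rfl, rfl, h0⟩, hS, ho⟩ := mem_Ev.1 hω
  have := conn_of_path (R := Set.univ) (Nat.zero_le u) hS ho (fun _ _ _ => trivial)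
  rw [h0] at this
  exact ⟨_, this⟩

lemma prob_QH_le (p : ℝ) (w t : ℕ) : (P 1 p).real (Ev (QH 0 w t)) ≤ H p w t := by
  refine measureReal_mono ?_
  intro ω hω
  obtain ⟨π, s, u, ⟨hsu, hu, h, h1⟩, hS, ho⟩ := mem_Ev.1 hω
  have hR : ∀ k, s ≤ k → k ≤ u → ((fun _ => π k : Fin 1 → ℤ), k) ∈ rect 0 w t :=
    fun k a b => ⟨(h k a b).1, (h k a b).2, b.trans hu⟩
  have := conn_of_path hsu hS ho hR
  rcases h1 with ⟨a, b⟩ | ⟨a, b⟩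
  · exact ⟨_, _, s, u, a, b, Or.inl this⟩
  · exact ⟨_, _, u, s, b, a, Or.inr this⟩

lemma vert_sub (w t : ℕ) (ht : 1 ≤ t) (n : ℕ) (hn : Even n) (hn2 : n ≤ t + 1) :
    {ω | CrossedVert ω 0 w (3 * t)} ⊆
      (Ev (QW 0 w t 0) ∩ Ev (QW 0 w t n)) ∪ Ev (QW 0 w t 1) := by
  rintro ω ⟨x, y, h⟩
  obtain ⟨-, π, -, -, hS, ho, hR⟩ := path_of_conn h
  have key : ∀ m, m ≤ t + 1 → Even (π m) → ω ∈ Ev (QW 0 w t m) := by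
    intro m hm he
    refine mem_Ev.2 ⟨π, m, m + t, ⟨rfl, rfl, he, fun k a b => ?_⟩,
      hS.sub (by omega) (by omega), fun k a b => ho k (by omega) (by omega)⟩
    obtain ⟨r1, r2, -⟩ := hR k (by omega) (by omega)
    exact ⟨r1, r2⟩
  have par : ∀ m, m ≤ 3 * t → (Even (π m) ↔ Even (π 0 + m)) := by
    intro m
    induction m with
    | zero => simp
    | succ m ih =>
      intro hm
      have := ih (by omega)
      have b := hS m (by omega) (by omega)
      rw [Int.even_iff, Int.even_iff] at *
      push_cast
      rcases (abs_eq (by norm_num)).1 b with b | b <;> omega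
  by_cases h0 : Even (π 0)
  · left
    refine ⟨key 0 (by omega) h0, key n hn2 ((par n (by omega)).2 ?_)⟩
    exact h0.add (by exact_mod_cast hn)
  · right
    refine key 1 (by omega) ((par 1 (by omega)).2 ?_)
    rw [Int.even_iff] at *
    push_cast
    omega

lemma V_le (p : ℝ) (w t : ℕ) (ht : 1 ≤ t) :
    V p w (3 * t) ≤ 1 - (1 - (P 1 p).real (Ev (QW 0 w t 0)) ^ 2) *
      (1 - (P 1 p).real (Ev (QW 0 w t 0))) := by
  obtain ⟨n, hn, hn1, hn2⟩ : ∃ n : ℕ, Even n ∧ t ≤ n ∧ n ≤ t + 1 := by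
    by_cases h : Even t
    · exact ⟨t, h, le_rfl, by omega⟩
    · exact ⟨t + 1, by rw [Nat.even_iff] at *; omega, by omega, le_rfl⟩
  set N := w + 3 * t
  have s0 := sup_QW 0 w t 0 N (by omega) (by omega) (by omega)
  have s1 := sup_QW 0 w t 1 N (by omega) (by omega) (by omega)
  have sn := sup_QW 0 w t n N (by omega) (by omega) (by omega)
  have bsub : ∀ l r, timF N l r ⊆ box N := fun l r => Finset.filter_subset _ _
  have d0 := s0.dep.mono (bsub _ _)
  have d1 := s1.dep.mono (bsub _ _)
  have dn := sn.dep.mono (bsub _ _)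
  have h1 : V p w (3 * t) ≤
      (P 1 p).real ((Ev (QW 0 w t 0) ∩ Ev (QW 0 w t n)) ∪ Ev (QW 0 w t 1)) :=
    measureReal_mono (vert_sub w t ht n hn hn2)
  have h2 := measureReal_union_add_inter (μ := P 1 p) (s := Ev (QW 0 w t 0) ∩ Ev (QW 0 w t n))
    d1.measurable
  have h3 := prob_fkg p (d0.inter dn) d1 ((Ev_incr _).inter (Ev_incr _)) (Ev_incr _)
  have h4 := prob_indep p s0.dep sn.dep (timF_disj (by omega))
  have h5 := prob_QW_shift p w t n
  have h6 := prob_QW_shift p w t 1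
  set a := (P 1 p).real (Ev (QW 0 w t 0))
  set b := (P 1 p).real (Ev (QW 0 w t n))
  set c := (P 1 p).real (Ev (QW 0 w t 1))
  have a0 : 0 ≤ a := measureReal_nonneg
  have a1 : a ≤ 1 := measureReal_le_one
  have b0 : 0 ≤ b := measureReal_nonneg
  have c0 : 0 ≤ c := measureReal_nonneg
  rw [h4] at h2 h3
  have h7 : V p w (3 * t) ≤ a * b + c - a * b * c := by linarith
  have h8 : (1 - a ^ 2) * (1 - a) ≤ (1 - a * b) * (1 - c) := by
    apply mul_le_mul
    · nlinarith
    · linarith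
    · linarith
    · nlinarith
  nlinarith

/-! The comparison of `r` with `θ`. -/

lemma glue {ω : Config 1} {π ρ : ℕ → ℤ} {k u t : ℕ} (hku : k ≤ u)
    (h0 : π 0 = 0) (hS : Stp π 0 u) (ho : ∀ i, 0 ≤ i → i < u → ω (bd (π i) i (π (i + 1))) = true)
    (hS' : Stp ρ 0 t) (ho' : ∀ i, 0 ≤ i → i < t → ω (bd (ρ i) i (ρ (i + 1))) = true)
    (hk : π k = ρ k) : ω ∈ Ev (QS t) := by
  have e : ∀ i, i ≤ k → (if i ≤ k then π i else ρ i) = π i := fun i hi => if_pos hi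
  have e' : ∀ i, k ≤ i → (if i ≤ k then π i else ρ i) = ρ i := by
    intro i hi
    rcases hi.eq_or_lt with rfl | hi
    · simp [hk]
    · exact if_neg (by omega)
  refine mem_Ev.2 ⟨fun i => if i ≤ k then π i else ρ i, 0, t, ⟨rfl, rfl, by simp [h0]⟩, ?_, ?_⟩
  · intro i _ hi
    rcases Nat.lt_or_ge i k with h | h
    · simp only [e i h.le, e (i + 1) h]
      exact hS i (by omega) (by omega)
    · simp only [e' i h, e' (i + 1) (by omega)]
      exact hS' i (by omega) (by omega)
  · intro i _ hi
    rcases Nat.lt_or_ge i k with h | h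
    · simp only [e i h.le, e (i + 1) h]
      exact ho i (by omega) (by omega)
    · simp only [e' i h, e' (i + 1) (by omega)]
      exact ho' i (by omega) (by omega)

lemma right_sub (w t : ℕ) : Ev (QR w t) ∩ Ev (QW 0 w t 0) ⊆ Ev (QS t) := by
  rintro ω ⟨h, h'⟩
  obtain ⟨π, s, u, ⟨rfl, hu, h0, h1⟩, hS, ho⟩ := mem_Ev.1 h
  obtain ⟨ρ, s, v, ⟨rfl, rfl, he, hr⟩, hS', ho'⟩ := mem_Ev.1 h'
  rw [Nat.zero_add] at hS' ho' hr
  have r0 := hr 0 le_rfl (by omega)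
  have ru := hr u (by omega) hu
  obtain ⟨k, k1, k2, k3⟩ := meet (Nat.zero_le u) hS (hS'.sub le_rfl hu)
    (by rw [h0, zero_sub]; exact he.neg) (by omega) (by omega)
  exact glue k2 h0 hS ho hS' ho' k3

lemma left_sub (w t : ℕ) : Ev (QR (-w) t) ∩ Ev (QW (-w) 0 t 0) ⊆ Ev (QS t) := by
  rintro ω ⟨h, h'⟩
  obtain ⟨π, s, u, ⟨rfl, hu, h0, h1⟩, hS, ho⟩ := mem_Ev.1 h
  obtain ⟨ρ, s, v, ⟨rfl, rfl, he, hr⟩, hS', ho'⟩ := mem_Ev.1 h'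
  rw [Nat.zero_add] at hS' ho' hr
  have r0 := hr 0 le_rfl (by omega)
  have ru := hr u (by omega) hu
  obtain ⟨k, k1, k2, k3⟩ := meet (Nat.zero_le u) (hS'.sub le_rfl hu) hS
    (by rw [h0, sub_zero]; exact he) (by omega) (by omega)
  exact glue k2 h0 hS ho hS' ho' k3.symm

/-- The event of disjoint occurrence. -/
def BK (Q Q' : (ℕ → ℤ) → ℕ → ℕ → Prop) : Set (Config 1) :=
  {ω | ∃ K ∈ fam Q, ∃ L ∈ fam Q', (∀ b ∈ K, ω b = true) ∧ (∀ b ∈ L, ω b = true) ∧ ∀ b ∈ K, b ∉ L}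

lemma both_sub (w t : ℕ) (hw : 1 ≤ w) : Ev (QR w t) ∩ Ev (QR (-w) t) ⊆
    BK (QR w t) (QH (-w) (-w + w) t) ∪ BK (QR (-w) t) (QH 0 (0 + w) t) := by
  rintro ω ⟨h, h'⟩
  obtain ⟨π, s, u, ⟨rfl, hu, h0, h1⟩, hS, ho⟩ := mem_Ev.1 h
  obtain ⟨ρ, s, v, ⟨rfl, hv, h0', h1'⟩, hS', ho'⟩ := mem_Ev.1 h'
  have sp := Nat.findGreatest_spec (P := fun k => π k = ρ k) (Nat.zero_le (min u v)) (by rw [h0, h0'])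
  have gt := fun m => @Nat.findGreatest_is_greatest m (fun k => π k = ρ k) _ (min u v)
  have le := Nat.findGreatest_le (P := fun k => π k = ρ k) (min u v)
  generalize Nat.findGreatest (fun k => π k = ρ k) (min u v) = k at sp gt le
  have ndisj : ∀ i, k ≤ i → i < u → i < v → bd (π i) i (π (i + 1)) ≠ bd (ρ i) i (ρ (i + 1)) := by
    intro i a b c hb
    exact gt (i + 1) (by omega) (by omega) (bd_inj hb).2.2
  by_cases hk : 0 ≤ π k
  · left
    obtain ⟨s, v', a1, a2, a3, a4, a5, a6⟩ := crossing_down (f := ρ) (k := k) (u := v)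
      (a := -w) (b := -w + w) (by omega) (hS'.sub (by omega) le_rfl) (by omega) (by omega)
      (by omega)
    refine ⟨_, ⟨π, 0, u, ⟨rfl, hu, h0, h1⟩, hS, rfl⟩, _, ⟨ρ, s, v', ⟨a2, a3.trans hv, a6,
      Or.inr ⟨a4, a5⟩⟩, hS'.sub (by omega) a3, rfl⟩, ?_, ?_, ?_⟩
    · rintro _ ⟨i, i1, i2, rfl⟩; exact ho i i1 i2
    · rintro _ ⟨i, i1, i2, rfl⟩; exact ho' i (by omega) (by omega)
    · rintro _ ⟨i, i1, i2, rfl⟩ ⟨l, l1, l2, hl⟩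
      obtain rfl := (bd_inj hl).2.1
      exact ndisj i (by omega) i2 (by omega) hl
  · right
    obtain ⟨s, v', a1, a2, a3, a4, a5, a6⟩ := crossing_up (f := π) (k := k) (u := u)
      (a := 0) (b := 0 + w) (by omega) (hS.sub (by omega) le_rfl) (by omega) (by omega)
      (by omega)
    refine ⟨_, ⟨ρ, 0, v, ⟨rfl, hv, h0', h1'⟩, hS', rfl⟩, _, ⟨π, s, v', ⟨a2, a3.trans hu, a6,
      Or.inl ⟨a4, a5⟩⟩, hS.sub (by omega) a3, rfl⟩, ?_, ?_, ?_⟩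
    · rintro _ ⟨i, i1, i2, rfl⟩; exact ho' i i1 i2
    · rintro _ ⟨i, i1, i2, rfl⟩; exact ho i (by omega) (by omega)
    · rintro _ ⟨i, i1, i2, rfl⟩ ⟨l, l1, l2, hl⟩
      obtain rfl := (bd_inj hl).2.1
      exact ndisj i (by omega) (by omega) i2 hl.symm

lemma box_mono {N M : ℕ} (h : N ≤ M) : box N ⊆ box M := by
  intro b hb
  rw [box, Finset.mem_image] at hb
  obtain ⟨⟨⟨a, s⟩, c⟩, hq, rfl⟩ := hb
  simp only [Finset.mem_product, Finset.mem_Icc, Finset.mem_range] at hq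
  dsimp only
  exact mem_box (abs_le.2 (by omega)) (by omega) (abs_le.2 (by omega))

lemma Sup.mono {F G : Finset (Bond 1)} {Q : (ℕ → ℤ) → ℕ → ℕ → Prop} (h : Sup F Q) (hFG : F ⊆ G) :
    Sup G Q := fun π s u a b k c d => hFG (h π s u a b k c d)

lemma prob_both (p : ℝ) (w t : ℕ) (hw : 1 ≤ w) (δ : ℝ) (hH : H p w (3 * t) ≤ δ) :
    (P 1 p).real (Ev (QR w t) ∩ Ev (QR (-w) t)) ≤ 2 * (P 1 p).real (Ev (QR w t)) * δ := by
  have h1 : (P 1 p).real (Ev (QR w t) ∩ Ev (QR (-w) t)) ≤ _ := measureReal_mono (both_sub w t hw)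
  have h2 := measureReal_union_le (μ := P 1 p) (BK (QR w t) (QH (-w) (-w + w) t))
    (BK (QR (-w) t) (QH 0 (0 + w) t))
  have bsub : ∀ l r, colF (w + t) l r ⊆ box (w + t) := fun l r => Finset.filter_subset _ _
  have hr : ∀ c, Sup (box (w + t)) (QR c t) := fun c => (sup_QR c t).mono (box_mono (by omega))
  have hq1 : Sup (box (w + t)) (QH (-w) (-w + w) t) :=
    (sup_QH (-w) (-w + w) t (w + t) (by push_cast; omega) (by push_cast; omega)
      (by omega)).mono (bsub _ _)
  have hq2 : Sup (box (w + t)) (QH 0 (0 + w) t) :=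
    (sup_QH 0 (0 + w) t (w + t) (by push_cast; omega) (by push_cast; omega)
      (by omega)).mono (bsub _ _)
  have h3 : (P 1 p).real (BK (QR w t) (QH (-w) (-w + w) t)) ≤
      (P 1 p).real (Ev (QR w t)) * (P 1 p).real (Ev (QH (-w) (-w + w) t)) :=
    prob_bk p _ _ _ (hr w).fam hq1.fam
  have h4 : (P 1 p).real (BK (QR (-w) t) (QH 0 (0 + w) t)) ≤
      (P 1 p).real (Ev (QR (-w) t)) * (P 1 p).real (Ev (QH 0 (0 + w) t)) :=
    prob_bk p _ _ _ (hr (-w)).fam hq2.fam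
  have hh : ∀ c : ℤ, (P 1 p).real (Ev (QH c (c + w) t)) ≤ δ := fun c =>
    (prob_QH_shift p c w t (3 * t) (by omega)).trans ((prob_QH_le p w (3 * t)).trans hH)
  have h5 := hh (-w)
  have h6 := hh 0
  have h7 := prob_QR_neg p w t
  have n1 : 0 ≤ (P 1 p).real (Ev (QR w t)) := measureReal_nonneg
  have n2 : 0 ≤ (P 1 p).real (Ev (QR (-w) t)) := measureReal_nonneg
  have n3 : 0 ≤ (P 1 p).real (Ev (QH 0 (0 + w) t)) := measureReal_nonneg
  have h8 := mul_le_mul_of_nonneg_left h5 n1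
  have h9 := mul_le_mul h7 h6 n3 n1
  linarith

lemma theta_ge (p : ℝ) (w t : ℕ) (hw : 1 ≤ w) (δ : ℝ) (hH : H p w (3 * t) ≤ δ) :
    (P 1 p).real (Ev (QR w t)) * (P 1 p).real (Ev (QW 0 w t 0)) ≤ theta 1 p t ∧
    2 * (P 1 p).real (Ev (QR w t)) * (P 1 p).real (Ev (QW 0 w t 0)) -
      2 * (P 1 p).real (Ev (QR w t)) * δ ≤ theta 1 p t := by
  have bsub : ∀ l r, timF (w + t) l r ⊆ box (w + t) := fun l r => Finset.filter_subset _ _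
  have dr : ∀ c, Dep (box (w + t)) (Ev (QR c t)) := fun c =>
    ((sup_QR c t).mono (box_mono (by omega))).dep
  have d1 : Dep (box (w + t)) (Ev (QW 0 w t 0)) :=
    ((sup_QW 0 w t 0 (w + t) (by omega) (by omega) (by omega)).mono (bsub _ _)).dep
  have d2 : Dep (box (w + t)) (Ev (QW (-w) 0 t 0)) :=
    ((sup_QW (-w) 0 t 0 (w + t) (by omega) (by omega) (by omega)).mono (bsub _ _)).dep
  have f1 := prob_fkg p (dr w) d1 (Ev_incr _) (Ev_incr _)
  have f2 := prob_fkg p (dr (-w)) d2 (Ev_incr _) (Ev_incr _)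
  have hth := prob_QS_le p t
  have g1 : (P 1 p).real (Ev (QR w t) ∩ Ev (QW 0 w t 0)) ≤ (P 1 p).real (Ev (QS t)) :=
    measureReal_mono (right_sub w t)
  have g2 : (P 1 p).real ((Ev (QR w t) ∩ Ev (QW 0 w t 0)) ∪ (Ev (QR (-w) t) ∩ Ev (QW (-w) 0 t 0)))
      ≤ (P 1 p).real (Ev (QS t)) :=
    measureReal_mono (Set.union_subset (right_sub w t) (left_sub w t))
  have g3 := measureReal_union_add_inter (μ := P 1 p) (s := Ev (QR w t) ∩ Ev (QW 0 w t 0))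
    ((dr (-w)).inter d2).measurable
  have g4 : (P 1 p).real ((Ev (QR w t) ∩ Ev (QW 0 w t 0)) ∩ (Ev (QR (-w) t) ∩ Ev (QW (-w) 0 t 0)))
      ≤ (P 1 p).real (Ev (QR w t) ∩ Ev (QR (-w) t)) :=
    measureReal_mono fun ω hω => ⟨hω.1.1, hω.2.1⟩
  have g5 := prob_both p w t hw δ hH
  have g6 := prob_QW_neg p w t
  have g7 := prob_QR_neg p (-w) t
  rw [neg_neg] at g7
  have n1 : 0 ≤ (P 1 p).real (Ev (QW 0 w t 0)) := measureReal_nonneg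
  have n2 : 0 ≤ (P 1 p).real (Ev (QR (-w) t)) := measureReal_nonneg
  have := mul_le_mul g7 g6 n1 n2
  exact ⟨by linarith, by linarith⟩

/-! ### Real inequality -/

lemma real_ineq {ε a r θ : ℝ} (h0 : 0 < ε) (h1 : ε < 1) (a0 : 0 ≤ a) (a1 : a ≤ 1) (r0 : 0 ≤ r)
    (hV : ε ≤ 1 - (1 - a ^ 2) * (1 - a)) (hθ1 : r * a ≤ θ)
    (hθ2 : 2 * r * a - 2 * r * (1 - ε) ≤ θ) : r * ε ^ 2 ≤ θ := by
  by_cases ha : ε ^ 2 ≤ a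
  · exact (mul_le_mul_of_nonneg_left ha r0).trans hθ1
  · push Not at ha
    have key : ε ^ 2 ≤ 2 * a - 2 * (1 - ε) := by
      have hq : (1 - a) ^ 2 ≤ 1 - ε := by nlinarith [mul_nonneg a0 (sq_nonneg (1 - a))]
      -- lower bound on `ε`
      have hm : (1 - ε ^ 4) * (1 - ε ^ 2) ≤ (1 - a ^ 2) * (1 - a) := by
        have e2 : ε ^ 2 ≤ 1 := by nlinarith
        apply mul_le_mul
        · have : a ^ 2 ≤ (ε ^ 2) ^ 2 := pow_le_pow_left₀ a0 ha.le 2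
          nlinarith
        · linarith
        · linarith
        · nlinarith
      have hm2 : (1 - ε) * ((1 - ε) * (1 + ε) ^ 2 * (1 + ε ^ 2)) ≤ (1 - ε) * 1 := by
        have : (1 - ε) * ((1 - ε) * (1 + ε) ^ 2 * (1 + ε ^ 2)) = (1 - ε ^ 4) * (1 - ε ^ 2) := by ring
        rw [this]; linarith
      have hm3 : (1 - ε) * (1 + ε) ^ 2 * (1 + ε ^ 2) ≤ 1 :=
        le_of_mul_le_mul_left hm2 (by linarith)
      have he : 4 / 5 ≤ ε := by
        by_contra hc
        push Not at hc
        have : 1 < (1 - ε) * (1 + ε) ^ 2 * (1 + ε ^ 2) := by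
          have : (1 - ε) * (1 + ε) ^ 2 * (1 + ε ^ 2) = 1 + ε * (1 - ε ^ 3 * (1 + ε)) := by ring
          rw [this]
          have h3 : ε ^ 3 ≤ (4 / 5) ^ 3 := pow_le_pow_left₀ h0.le hc.le 3
          have h4 : ε ^ 3 * (1 + ε) < 1 := by
            have : 0 ≤ ε ^ 3 := by positivity
            nlinarith
          nlinarith
        linarith
      by_contra hc
      push Not at hc
      have hb : 1 - a > ε - ε ^ 2 / 2 := by linarith
      have hb2 : (ε - ε ^ 2 / 2) ^ 2 < (1 - a) ^ 2 := by
        apply pow_lt_pow_left₀ hb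
        · nlinarith
        · norm_num
      nlinarith [mul_pos h0 h0, sq_nonneg (ε - 4 / 5), mul_nonneg (sub_nonneg.2 he) (sub_nonneg.2 h1.le)]
    nlinarith [mul_le_mul_of_nonneg_left key r0]

/-! ### The two-point function -/

/-- The origin reaches column `w`, and the next `n` slabs are crossed. -/
def GG (w t : ℕ) : ℕ → Set (Config 1)
  | 0 => Ev (Q1 w t)
  | n + 1 => GG w t n ∩ Ev (QH (((n : ℤ) + 1) * w) (((n : ℤ) + 1) * w + w) t)

lemma GG_dep (w t N n : ℕ) (hN : t ≤ N) (hN2 : (n + 1) * w ≤ N) :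
    Dep (colF N (-N) (((n : ℤ) + 1) * w)) (GG w t n) := by
  induction n with
  | zero => simpa [GG] using (sup_Q1 w t N hN).dep
  | succ n ih =>
    have e : (n + 1 + 1) * w = (n + 1) * w + w := by ring
    have i := ih (by omega)
    have hz : ((n : ℤ) + 1) * w = (((n + 1) * w : ℕ) : ℤ) := by push_cast; ring
    have e2 : (((n + 1 : ℕ) : ℤ) + 1) * w = ((n : ℤ) + 1) * w + w := by push_cast; ring
    rw [e2]
    refine (i.mono (colF_mono le_rfl (by omega))).inter
      ((sup_QH _ _ t N ?_ ?_ hN).dep.mono (colF_mono ?_ le_rfl))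
    · rw [hz]; omega
    · rw [hz]; omega
    · rw [hz]; omega

lemma GG_prob (p : ℝ) (w t N n : ℕ) (hN : t ≤ N) (hN2 : (n + 1) * w ≤ N) (δ : ℝ) (hδ : 0 ≤ δ)
    (hH : H p w (3 * t) ≤ δ) :
    (P 1 p).real (GG w t n) ≤ (P 1 p).real (Ev (QR w t)) * δ ^ n := by
  induction n with
  | zero => simpa [GG] using prob_Q1 p w t
  | succ n ih =>
    have e : (n + 1 + 1) * w = (n + 1) * w + w := by ring
    have i := ih (by omega)
    have hz : ((n : ℤ) + 1) * w = (((n + 1) * w : ℕ) : ℤ) := by push_cast; ring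
    have ind := prob_indep p (GG_dep w t N n hN (by omega))
      (sup_QH (((n : ℤ) + 1) * w) (((n : ℤ) + 1) * w + w) t N (by rw [hz]; omega)
        (by rw [hz]; omega) hN).dep (colF_disj le_rfl)
    have hh : (P 1 p).real (Ev (QH (((n : ℤ) + 1) * w) (((n : ℤ) + 1) * w + w) t)) ≤ δ :=
      (prob_QH_shift p _ w t (3 * t) (by omega)).trans ((prob_QH_le p w (3 * t)).trans hH)
    rw [GG, ind, pow_succ, ← mul_assoc]
    exact mul_le_mul i hh measureReal_nonneg (mul_nonneg measureReal_nonneg (pow_nonneg hδ n))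

lemma path_GG (w t : ℕ) (hw : 1 ≤ w) (ω : Config 1) (π : ℕ → ℤ) (x : ℤ) (h0 : π 0 = 0) (hx : π t = x)
    (hS : Stp π 0 t) (ho : ∀ k, 0 ≤ k → k < t → ω (bd (π k) k (π (k + 1))) = true)
    (n : ℕ) (hn : ((n : ℤ) + 1) * w ≤ x) : ω ∈ GG w t n := by
  induction n with
  | zero =>
    obtain ⟨v, v1, v2, v3, v4⟩ := first_hit (a := -w) (Nat.zero_le t) hS.neg (by omega)
      (by rw [hx]; simp at hn; omega)
    refine mem_Ev.2 ⟨π, 0, v, ⟨rfl, v2, h0, by omega, fun k hk => ?_⟩, hS.sub le_rfl v2,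
      fun k a b => ho k a (by omega)⟩
    rcases hk.eq_or_lt with rfl | hk
    · omega
    · have := v4 k (by omega) hk
      omega
  | succ n ih =>
    have e2 : (((n + 1 : ℕ) : ℤ) + 1) * w = ((n : ℤ) + 1) * w + w := by push_cast; ring
    rw [e2] at hn
    have hp : 0 ≤ ((n : ℤ) + 1) * w := by positivity
    refine ⟨ih (by omega), ?_⟩
    obtain ⟨s, v, a1, a2, a3, a4, a5, a6⟩ := crossing_up (a := ((n : ℤ) + 1) * w)
      (b := ((n : ℤ) + 1) * w + w) (Nat.zero_le t) hS (by omega) (by omega) (by omega)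
    exact mem_Ev.2 ⟨π, s, v, ⟨a2, a3, a6, Or.inl ⟨a4, a5⟩⟩, hS.sub a1 a3,
      fun k a b => ho k (by omega) (by omega)⟩

lemma path_Q3 (w t : ℕ) (hw : 1 ≤ w) (ω : Config 1) (π : ℕ → ℤ) (x : ℤ) (h0 : π 0 = 0) (hx : π t = x)
    (hS : Stp π 0 t) (ho : ∀ k, 0 ≤ k → k < t → ω (bd (π k) k (π (k + 1))) = true)
    (hn : (w : ℤ) ≤ x) : ω ∈ Ev (Q3 w x t) := by
  obtain ⟨v, v1, v2, v3, v4⟩ := last_hit (b := -(x - w)) (Nat.zero_le t) hS.neg (by omega)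
    (by omega)
  refine mem_Ev.2 ⟨π, v, t, ⟨rfl, v2.le, by omega, hx, fun k a b => ?_⟩, hS.sub v1 le_rfl,
      fun k a b => ho k (by omega) b⟩
  rcases a.eq_or_lt with rfl | hk
  · omega
  · have := v4 k hk b
    omega

lemma tau_le (p : ℝ) (w t n : ℕ) (hw : 1 ≤ w) (x : ℤ) (hx : ((n : ℤ) + 2) * w < x) (δ : ℝ)
    (hδ : 0 ≤ δ) (hH : H p w (3 * t) ≤ δ) :
    tau 1 p (fun _ => x) t ≤ (P 1 p).real (Ev (QR w t)) ^ 2 * δ ^ n := by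
  have e : ((n : ℤ) + 2) * w = ((n : ℤ) + 1) * w + w := by ring
  have hp : 0 ≤ ((n : ℤ) + 1) * w := by positivity
  have hsub : tau 1 p (fun _ => x) t ≤ (P 1 p).real (GG w t n ∩ Ev (Q3 w x t)) := by
    refine measureReal_mono ?_
    intro ω hω
    obtain ⟨-, π, h0, h1, hS, ho, -⟩ := path_of_conn hω
    exact ⟨path_GG w t hw ω π x h0 h1 hS ho n (by omega), path_Q3 w t hw ω π x h0 h1 hS ho (by omega)⟩
  have hz : ((n : ℤ) + 1) * w = (((n + 1) * w : ℕ) : ℤ) := by push_cast; ring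
  obtain ⟨N, hN1, hN2, hN3⟩ : ∃ N : ℕ, t ≤ N ∧ (n + 1) * w ≤ N ∧ |x| + t + 1 ≤ N := by
    refine ⟨t + (n + 1) * w + x.natAbs + 1, by omega, by omega, ?_⟩
    have : |x| = (x.natAbs : ℤ) := Int.abs_eq_natAbs x
    rw [this]
    push_cast
    have := hp
    omega
  have ind := prob_indep p (GG_dep w t N n hN1 hN2) (sup_Q3 w x t N hN3).dep
    (colF_disj (by omega))
  have h1 := GG_prob p w t N n hN1 hN2 δ hδ hH
  have h2 := prob_Q3 p w x t
  rw [ind] at hsub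
  refine hsub.trans ((mul_le_mul h1 h2 measureReal_nonneg ?_).trans (le_of_eq (by ring)))
  exact mul_nonneg measureReal_nonneg (pow_nonneg hδ n)


/-- Lemma 2.1(ii): let `d = 1`, `p = p_c`, `ε ∈ (0,1)`, `t ≥ 1`, and let
`w ≥ 1` be an integer with `V_{p_c}(w, 3t) ≥ ε` and `H_{p_c}(w, 3t) ≤ 1 - ε`.  Then for all
integers `j ≥ 2` and `x` with `j w < x ≤ (j+1) w` and `x + t` even,
`τ(x,t) ≤ ε⁻⁴ θ_t² (1-ε)^{j-2}`. -/
theorem two_point_upper_bound (ε : ℝ) (hε : ε ∈ Set.Ioo (0 : ℝ) 1)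
    (t : ℕ) (ht : 1 ≤ t) (w : ℕ) (hw : 1 ≤ w)
    (hV : ε ≤ V (pc 1) w (3 * t)) (hH : H (pc 1) w (3 * t) ≤ 1 - ε)
    (j : ℕ) (hj : 2 ≤ j) (x : ℤ) (hx1 : (j : ℤ) * w < x) (hx2 : x ≤ ((j : ℤ) + 1) * w)
    (hpar : Even (x + (t : ℤ))) :
    tau 1 (pc 1) (fun _ => x) t ≤ ε ^ (-4 : ℤ) * theta 1 (pc 1) t ^ 2 * (1 - ε) ^ (j - 2) := by
  obtain ⟨h0, h1⟩ := hε
  obtain ⟨n, rfl⟩ : ∃ n, j = n + 2 := ⟨j - 2, by omega⟩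
  have hδ : 0 ≤ 1 - ε := by linarith
  have hτ := tau_le (pc 1) w t n hw x (by push_cast at hx1; exact hx1) (1 - ε) hδ hH
  obtain ⟨t1, t2⟩ := theta_ge (pc 1) w t hw (1 - ε) hH
  have hr : (P 1 (pc 1)).real (Ev (QR w t)) * ε ^ 2 ≤ theta 1 (pc 1) t :=
    real_ineq h0 h1 measureReal_nonneg measureReal_le_one measureReal_nonneg
      (hV.trans (V_le (pc 1) w t ht)) t1 t2
  have r0 : 0 ≤ (P 1 (pc 1)).real (Ev (QR w t)) := measureReal_nonneg
  set r := (P 1 (pc 1)).real (Ev (QR w t))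
  have hsq : (r * ε ^ 2) ^ 2 ≤ theta 1 (pc 1) t ^ 2 :=
    pow_le_pow_left₀ (mul_nonneg r0 (by positivity)) hr 2
  have e4 : ε ^ (-4 : ℤ) = (ε ^ 4)⁻¹ := by
    rw [zpow_neg]; norm_cast
  have hfin : r ^ 2 ≤ ε ^ (-4 : ℤ) * theta 1 (pc 1) t ^ 2 := by
    rw [e4, inv_mul_eq_div, le_div_iff₀ (by positivity)]
    calc r ^ 2 * ε ^ 4 = (r * ε ^ 2) ^ 2 := by ring
      _ ≤ _ := hsq
  rw [Nat.add_sub_cancel]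
  exact hτ.trans (mul_le_mul_of_nonneg_right hfin (pow_nonneg hδ n))

end OrientedPercolation
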